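/- A functional Z : Conv_sc(ℝⁿ) → ℝ is a continuous and epi-translation invariant valuation that is epi-homogeneous of degree n, if and only if there exists ζ ∈ C_c(ℝⁿ) such that Z(u) = ∫_{dom(u)} ζ(∇u(x)) dx for every u ∈ Conv_sc(ℝⁿ). -/

import Mathlib

open Filter Topology MeasureTheory

noncomputable section

/-- Euclidean space `ℝⁿ`. -/
abbrev Vn (n : ℕ) := EuclideanSpace ℝ (Fin n)

/-- `u : ℝⁿ → ℝ ∪ {+∞}` (represented as an `EReal`-valued function that never
takes the value `⊥ = -∞`) is convex. -/
def IsConvexFn {n : ℕ} (u : Vn n → EReal) : Prop :=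
  ∀ x y : Vn n, ∀ t : ℝ, 0 < t → t < 1 →
    u (t • x + (1 - t) • y) ≤ (t : EReal) * u x + ((1 - t : ℝ) : EReal) * u y

/-- `Conv(ℝⁿ)`: convex, lower semicontinuous, proper functions
`ℝⁿ → ℝ ∪ {+∞}`. -/
def ConvSet (n : ℕ) : Set (Vn n → EReal) :=
  {u | IsConvexFn u ∧ LowerSemicontinuous u ∧ (∀ x, u x ≠ ⊥) ∧ (∃ x, u x ≠ ⊤)}

/-- `Conv_sc(ℝⁿ)`: super-coercive elements of `Conv(ℝⁿ)`, i.e.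
`u(x)/|x| → +∞` as `|x| → +∞`. -/
def ConvSc (n : ℕ) : Set (Vn n → EReal) :=
  {u | u ∈ ConvSet n ∧
    ∀ M : ℝ, ∃ R : ℝ, ∀ x : Vn n, R ≤ ‖x‖ → ((M * ‖x‖ : ℝ) : EReal) ≤ u x}

/-- Epi-convergence of a sequence `uk` to `u`. -/
def EpiConverges {n : ℕ} (uk : ℕ → Vn n → EReal) (u : Vn n → EReal) : Prop :=
  ∀ x : Vn n,
    (∀ xk : ℕ → Vn n, Tendsto xk atTop (𝓝 x) →
      u x ≤ liminf (fun k => uk k (xk k)) atTop) ∧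
    (∃ xk : ℕ → Vn n, Tendsto xk atTop (𝓝 x) ∧
      Tendsto (fun k => uk k (xk k)) atTop (𝓝 (u x)))

/-- Continuity (with respect to epi-convergence) of a functional on a class `X`. -/
def ContinuousVal {n : ℕ} (X : Set (Vn n → EReal)) (Z : (Vn n → EReal) → ℝ) : Prop :=
  ∀ (uk : ℕ → Vn n → EReal) (u : Vn n → EReal),
    (∀ k, uk k ∈ X) → u ∈ X → EpiConverges uk u →
      Tendsto (fun k => Z (uk k)) atTop (𝓝 (Z u))

/-- The valuation property on a class `X` (here `⊔`, `⊓` are the pointwise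
maximum and minimum). -/
def IsValuation {n : ℕ} (X : Set (Vn n → EReal)) (Z : (Vn n → EReal) → ℝ) : Prop :=
  ∀ u v : Vn n → EReal, u ∈ X → v ∈ X → u ⊔ v ∈ X → u ⊓ v ∈ X →
    Z (u ⊔ v) + Z (u ⊓ v) = Z u + Z v

/-- Epi-translation invariance: invariance under `u ↦ u(· - x₀) + c`. -/
def EpiTranslationInvariant {n : ℕ} (X : Set (Vn n → EReal)) (Z : (Vn n → EReal) → ℝ) : Prop :=
  ∀ u ∈ X, ∀ x₀ : Vn n, ∀ c : ℝ, Z (fun x => u (x - x₀) + (c : EReal)) = Z u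

-- Epi-multiplication `λ ⊡ u`; for `λ = 0` it is the indicator of `{0}`.
open Classical in
def epiMul {n : ℕ} (l : ℝ) (u : Vn n → EReal) : Vn n → EReal :=
  if l = 0 then (fun x => if x = 0 then (0 : EReal) else ⊤)
  else fun x => (l : EReal) * u (l⁻¹ • x)

/-- `Z` is epi-homogeneous of degree `α`: `Z(λ ⊡ u) = λ^α Z(u)` for `λ > 0`. -/
def EpiHomogeneous {n : ℕ} (X : Set (Vn n → EReal)) (Z : (Vn n → EReal) → ℝ) (α : ℝ) : Prop :=
  ∀ u ∈ X, ∀ l : ℝ, 0 < l → Z (epiMul l u) = l ^ α * Z u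


namespace Cl
variable {n : ℕ}

/-- effective domain -/
def dm (u : Vn n → EReal) : Set (Vn n) := {x | u x ≠ ⊤}

/-- real-valued representative -/
def rl (u : Vn n → EReal) : Vn n → ℝ := fun y => (u y).toReal

theorem coe_rl {u : Vn n → EReal} (hb : ∀ x, u x ≠ ⊥) {x : Vn n} (hx : x ∈ dm u) :
    ((rl u x : ℝ) : EReal) = u x := EReal.coe_toReal hx (hb x)

theorem cvx_epi {u : Vn n → EReal} (hu : IsConvexFn u) {x y : Vn n} {t a b : ℝ} (h0 : 0 < t)
    (h1 : t < 1) (ha : u x ≤ (a : EReal)) (hb : u y ≤ (b : EReal)) :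
    u (t • x + (1 - t) • y) ≤ ((t * a + (1 - t) * b : ℝ) : EReal) := by
  refine (hu x y t h0 h1).trans ?_
  rw [EReal.coe_add, EReal.coe_mul, EReal.coe_mul]
  have h1' : (0 : EReal) ≤ ((1 - t : ℝ) : EReal) := by exact_mod_cast (by linarith : (0:ℝ) ≤ 1 - t)
  have h0' : (0 : EReal) ≤ ((t : ℝ) : EReal) := by exact_mod_cast h0.le
  exact add_le_add (mul_le_mul_of_nonneg_left ha h0') (mul_le_mul_of_nonneg_left hb h1')

theorem of_epi {u : Vn n → EReal} (hb : ∀ x, u x ≠ ⊥)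
    (h : ∀ x y : Vn n, ∀ t a b : ℝ, 0 < t → t < 1 → u x = (a : EReal) → u y = (b : EReal) →
      u (t • x + (1 - t) • y) ≤ ((t * a + (1 - t) * b : ℝ) : EReal)) : IsConvexFn u := by
  intro x y t h0 h1
  have h1' : 0 < 1 - t := by linarith
  by_cases hx : u x = ⊤
  · rw [hx, EReal.coe_mul_top_of_pos h0]
    have : ((1 - t : ℝ) : EReal) * u y ≠ ⊥ := by
      by_cases hy : u y = ⊤
      · rw [hy, EReal.coe_mul_top_of_pos h1']; simp
      · lift u y to ℝ using ⟨hy, hb y⟩ with r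
        rw [← EReal.coe_mul]; exact EReal.coe_ne_bot _
    rw [EReal.top_add_of_ne_bot this]; exact le_top
  by_cases hy : u y = ⊤
  · rw [hy, EReal.coe_mul_top_of_pos h1']
    have : (t : EReal) * u x ≠ ⊥ := by
      lift u x to ℝ using ⟨hx, hb x⟩ with r
      rw [← EReal.coe_mul]; exact EReal.coe_ne_bot _
    rw [EReal.add_top_of_ne_bot this]; exact le_top
  have e1 := EReal.coe_toReal hx (hb x)
  have e2 := EReal.coe_toReal hy (hb y)
  have := h x y t _ _ h0 h1 e1.symm e2.symm
  rw [EReal.coe_add, EReal.coe_mul, EReal.coe_mul, e1, e2] at this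
  exact this

theorem convexOn_rl {u : Vn n → EReal} (hu : IsConvexFn u) (hb : ∀ x, u x ≠ ⊥) :
    ConvexOn ℝ (dm u) (rl u) := by
  have key : ∀ x ∈ dm u, ∀ y ∈ dm u, ∀ t : ℝ, 0 < t → t < 1 →
      u (t • x + (1 - t) • y) ≤ ((t * rl u x + (1 - t) * rl u y : ℝ) : EReal) :=
    fun x hx y hy t h0 h1 => cvx_epi hu h0 h1 (coe_rl hb hx).ge (coe_rl hb hy).ge
  have key2 : ∀ x ∈ dm u, ∀ y ∈ dm u, ∀ t : ℝ, 0 < t → t < 1 → t • x + (1 - t) • y ∈ dm u :=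
    fun x hx y hy t h0 h1 => ((key x hx y hy t h0 h1).trans_lt (EReal.coe_lt_top _)).ne
  have cv : Convex ℝ (dm u) := by
    rw [convex_iff_forall_pos]
    intro x hx y hy a b ha hb hab
    have : b = 1 - a := by linarith
    subst this
    exact key2 x hx y hy a ha (by linarith)
  rw [convexOn_iff_forall_pos]
  refine ⟨cv, fun x hx y hy a b ha hb' hab => ?_⟩
  have : b = 1 - a := by linarith
  subst this
  have h := key x hx y hy a ha (by linarith)
  rw [← coe_rl hb (key2 x hx y hy a ha (by linarith))] at h
  exact_mod_cast h

theorem convex_dm {u : Vn n → EReal} (hu : IsConvexFn u) (hb : ∀ x, u x ≠ ⊥) :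
    Convex ℝ (dm u) := (convexOn_rl hu hb).1

theorem ae_differentiable {s : Set (Vn n)} {f : Vn n → ℝ} (hf : ConvexOn ℝ s f) :
    ∀ᵐ x, x ∈ interior s → DifferentiableAt ℝ f x := by
  have hl := hf.locallyLipschitzOn_interior
  rw [← ae_restrict_iff'₀ isOpen_interior.measurableSet.nullMeasurableSet]
  have : ∀ x ∈ interior s, ∃ t ∈ 𝓝[interior s] x, ∀ᵐ y ∂volume.restrict t, DifferentiableAt ℝ f y := by
    intro x hx
    obtain ⟨K, t, ht, hK⟩ := hl hx
    rw [isOpen_interior.nhdsWithin_eq hx] at ht ⊢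
    refine ⟨interior t, interior_mem_nhds.2 ht, ?_⟩
    have := hK.ae_differentiableWithinAt_of_mem (μ := (volume : Measure (Vn n)))
    rw [ae_restrict_iff'₀ isOpen_interior.measurableSet.nullMeasurableSet]
    filter_upwards [this] with y hy hyt
    exact (hy (interior_subset hyt)).differentiableAt (mem_interior_iff_mem_nhds.1 hyt)
  choose! t ht ht2 using this
  obtain ⟨c, hc, hcc, hcu⟩ := TopologicalSpace.countable_cover_nhdsWithin ht
  have := (ae_restrict_biUnion_iff (μ := (volume : Measure (Vn n))) t hcc
    (fun y => DifferentiableAt ℝ f y)).2 (fun x hx => ht2 x (hc hx))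
  exact ae_restrict_of_ae_restrict_of_subset hcu this

/-- good points -/
def Good (u : Vn n → EReal) (x : Vn n) : Prop :=
  (x ∈ interior (dm u) ∧ DifferentiableAt ℝ (rl u) x) ∨ x ∉ closure (dm u)

theorem ae_good {u : Vn n → EReal} (hu : IsConvexFn u) (hb : ∀ x, u x ≠ ⊥) :
    ∀ᵐ x, Good u x := by
  have h1 := ae_differentiable (convexOn_rl hu hb)
  have h2 : ∀ᵐ x : Vn n, x ∉ frontier (dm u) := by
    exact compl_mem_ae_iff.2 ((convex_dm hu hb).addHaar_frontier volume)
  filter_upwards [h1, h2] with x a b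
  by_cases hx : x ∈ interior (dm u)
  · exact Or.inl ⟨hx, a hx⟩
  · refine Or.inr fun hc => b ⟨hc, hx⟩

theorem subgrad {u : Vn n → EReal} (hu : IsConvexFn u) (hb : ∀ x, u x ≠ ⊥) {x : Vn n}
    (hx : x ∈ dm u) (hd : DifferentiableAt ℝ (rl u) x) (y : Vn n) :
    ((rl u x + inner ℝ (gradient (rl u) x) (y - x) : ℝ) : EReal) ≤ u y := by
  by_cases hy : u y = ⊤
  · rw [hy]; exact le_top
  rw [← coe_rl hb hy]
  have hc := convexOn_rl hu hb
  norm_cast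
  have hdx := hd.hasGradientAt.hasFDerivAt
  let g : ℝ → Vn n := fun t => x + t • (y - x)
  have hg : HasDerivAt g (y - x) 0 := by
    simpa [g] using ((hasDerivAt_id (0:ℝ)).smul_const (y - x)).const_add x
  have hg0 : g 0 = x := by simp [g]
  have hfg : HasDerivAt (rl u ∘ g) (inner ℝ (gradient (rl u) x) (y - x)) 0 := by
    rw [← hg0] at hdx
    have := hdx.comp_hasDerivAt (0:ℝ) hg
    simpa [hg0] using this
  have hcg : ConvexOn ℝ (Set.Icc (0:ℝ) 1) (rl u ∘ g) := by
    have h3 := (hc.comp_affineMap (AffineMap.lineMap x y : ℝ →ᵃ[ℝ] Vn n))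
    have : (rl u ∘ g) = rl u ∘ (AffineMap.lineMap x y : ℝ →ᵃ[ℝ] Vn n) := by
      funext t; simp [g, AffineMap.lineMap_apply, add_comm]
    rw [this]
    refine h3.subset ?_ (convex_Icc 0 1)
    intro t ht
    exact hc.1.segment_subset hx hy (by rw [segment_eq_image_lineMap]; exact ⟨t, ht, rfl⟩)
  have := hcg.le_slope_of_hasDerivAt (by simp) (by simp) (zero_lt_one) hfg
  have h4 : slope (rl u ∘ g) 0 1 = rl u y - rl u x := by simp [slope_def_field, g]
  rw [h4] at this
  linarith

theorem subgrad_unique {u : Vn n → EReal} (hb : ∀ x, u x ≠ ⊥) {x p : Vn n}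
    (hx : x ∈ interior (dm u)) (hd : DifferentiableAt ℝ (rl u) x)
    (h : ∀ y, ((rl u x + inner ℝ p (y - x) : ℝ) : EReal) ≤ u y) : gradient (rl u) x = p := by
  have hm : IsLocalMin (fun y => rl u y - inner ℝ p (y - x)) x := by
    filter_upwards [isOpen_interior.mem_nhds hx] with y hy
    have := h y
    rw [← coe_rl hb (interior_subset hy)] at this
    have : rl u x + inner ℝ p (y - x) ≤ rl u y := by exact_mod_cast this
    simp; linarith
  have h1 : HasFDerivAt (fun y => rl u y - inner ℝ p (y - x))
      (InnerProductSpace.toDual ℝ _ (gradient (rl u) x) - InnerProductSpace.toDual ℝ _ p) x := by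
    refine hd.hasGradientAt.hasFDerivAt.sub ?_
    have := ((InnerProductSpace.toDual ℝ _ p).hasFDerivAt (x := x)).sub_const (inner ℝ p x)
    simpa [inner_sub_right] using this
  have h2 := hm.hasFDerivAt_eq_zero h1
  rw [sub_eq_zero] at h2
  exact (InnerProductSpace.toDual ℝ _).injective h2

end Cl


namespace Cl
variable {n : ℕ}

theorem epi_subseq {uk : ℕ → Vn n → EReal} {u : Vn n → EReal} (h : EpiConverges uk u)
    {φ : ℕ → ℕ} (hφ : StrictMono φ) : EpiConverges (fun j => uk (φ j)) u := by
  intro x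
  refine ⟨fun xk hx => ?_, ?_⟩
  · let y : ℕ → Vn n := Function.extend φ xk (fun _ => x)
    have hy : Tendsto y atTop (𝓝 x) := by
      rw [tendsto_nhds]
      intro U hU hxU
      obtain ⟨J, hJ⟩ := eventually_atTop.1 (hx.eventually (hU.mem_nhds hxU))
      filter_upwards [eventually_ge_atTop (φ J)] with k hk
      by_cases hkφ : ∃ j, φ j = k
      · obtain ⟨j, rfl⟩ := hkφ
        simp only [y, Set.mem_preimage, hφ.injective.extend_apply]
        exact hJ j (hφ.le_iff_le.1 hk)
      · simp only [y, Set.mem_preimage, Function.extend_apply' _ _ _ hkφ]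
        exact hxU
    refine ((h x).1 y hy).trans ?_
    have : (fun j => uk (φ j) (xk j)) = (fun k => uk k (y k)) ∘ φ := by
      funext j; simp [y, hφ.injective.extend_apply]
    rw [this, Filter.liminf_comp]
    exact liminf_le_liminf_of_le hφ.tendsto_atTop
  · obtain ⟨y, h1, h2⟩ := (h x).2
    exact ⟨y ∘ φ, h1.comp hφ.tendsto_atTop, h2.comp hφ.tendsto_atTop⟩

theorem epi_le {uk : ℕ → Vn n → EReal} {u : Vn n → EReal} (h : EpiConverges uk u)
    {x : ℕ → Vn n} {x0 : Vn n} (hx : Tendsto x atTop (𝓝 x0)) {c : ℕ → ℝ} {c0 : ℝ}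
    (hc : Tendsto c atTop (𝓝 c0)) (hle : ∀ᶠ j in atTop, uk j (x j) ≤ (c j : EReal)) :
    u x0 ≤ (c0 : EReal) := by
  refine ((h x0).1 x hx).trans ?_
  have : Tendsto (fun j => (c j : EReal)) atTop (𝓝 (c0 : EReal)) := EReal.tendsto_coe.2 hc
  rw [← this.liminf_eq]
  exact liminf_le_liminf hle

theorem epi_rec {uk : ℕ → Vn n → EReal} {u : Vn n → EReal} (h : EpiConverges uk u)
    (hb : ∀ x, u x ≠ ⊥) {x : Vn n} (hx : x ∈ dm u) :
    ∃ y : ℕ → Vn n, ∃ c : ℕ → ℝ, Tendsto y atTop (𝓝 x) ∧ Tendsto c atTop (𝓝 (rl u x)) ∧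
      ∀ᶠ k in atTop, uk k (y k) ≤ (c k : EReal) := by
  obtain ⟨y, h1, h2⟩ := (h x).2
  refine ⟨y, fun k => (uk k (y k)).toReal, h1, (EReal.tendsto_toReal hx (hb x)).comp h2, ?_⟩
  filter_upwards [h2.eventually_ne hx] with k hk
  exact EReal.le_coe_toReal hk

/-- `p` is a subgradient of `u` at `x` -/
def Sub (u : Vn n → EReal) (x p : Vn n) : Prop :=
  ∀ y, ((rl u x + inner ℝ p (y - x) : ℝ) : EReal) ≤ u y

theorem Sub.le {u : Vn n → EReal} {x p : Vn n} (h : Sub u x p) {y : Vn n} {c : ℝ}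
    (hy : u y ≤ (c : EReal)) : rl u x + inner ℝ p (y - x) ≤ c := by
  exact_mod_cast (h y).trans hy

theorem sub_limit {uk : ℕ → Vn n → EReal} {u : Vn n → EReal} (h : EpiConverges uk u)
    (hkb : ∀ k x, uk k x ≠ ⊥)
    (hb : ∀ x, u x ≠ ⊥) (hne : ∃ x, u x ≠ ⊤) {x0 q : Vn n} {p : ℕ → Vn n}
    (hx : ∀ j, x0 ∈ dm (uk j)) (hp : ∀ j, Sub (uk j) x0 (p j)) (hq : Tendsto p atTop (𝓝 q)) :
    x0 ∈ dm u ∧ Sub u x0 q := by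
  have key : ∀ y ∈ dm u, u x0 ≤ ((rl u y - inner ℝ q (y - x0) : ℝ) : EReal) := by
    intro y hy
    obtain ⟨z, c, hz, hc, hle⟩ := epi_rec h hb hy
    refine epi_le h (tendsto_const_nhds (x := x0)) (c := fun k => c k - inner ℝ (p k) (z k - x0))
      (hc.sub (hq.inner (hz.sub_const x0))) ?_
    filter_upwards [hle] with k hk
    rw [← coe_rl (hkb k) (hx k)]
    have := (hp k).le hk
    exact_mod_cast (by linarith : rl (uk k) x0 ≤ c k - inner ℝ (p k) (z k - x0))
  have hd : x0 ∈ dm u := by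
    obtain ⟨y, hy⟩ := hne
    exact ((key y hy).trans_lt (EReal.coe_lt_top _)).ne
  refine ⟨hd, fun y => ?_⟩
  by_cases hy : u y = ⊤
  · rw [hy]; exact le_top
  have := key y hy
  rw [← coe_rl hb hd] at this
  rw [← coe_rl hb hy]
  have h3 : rl u x0 ≤ rl u y - inner ℝ q (y - x0) := by exact_mod_cast this
  exact_mod_cast (by linarith : rl u x0 + inner ℝ q (y - x0) ≤ rl u y)

theorem sub_bdd {u : Vn n → EReal} (hu : u ∈ ConvSc n) (C : ℝ) :
    ∃ R, ∀ x p, ‖p‖ ≤ C → x ∈ dm u → Sub u x p → ‖x‖ ≤ R := by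
  obtain ⟨⟨-, -, hb, y, hy⟩, hsc⟩ := hu
  obtain ⟨R, hR⟩ := hsc (C + 1)
  refine ⟨max R (rl u y + C * ‖y‖), fun x p hp hx hs => ?_⟩
  by_contra! hlt
  have hRx : R ≤ ‖x‖ := (le_max_left _ _).trans hlt.le
  have h2 := hR x hRx
  rw [← coe_rl hb hx] at h2
  have h2 : (C + 1) * ‖x‖ ≤ rl u x := by exact_mod_cast h2
  have h3 := hs.le (coe_rl hb hy).ge
  have h4 : |inner ℝ p (y - x)| ≤ C * (‖y‖ + ‖x‖) :=
    (abs_real_inner_le_norm _ _).trans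
      (mul_le_mul hp (norm_sub_le _ _) (norm_nonneg _) ((norm_nonneg _).trans hp))
  have h5 := (abs_le.1 h4).1
  have := (le_max_right R (rl u y + C * ‖y‖)).trans_lt hlt
  nlinarith

theorem sub_equibdd {uk : ℕ → Vn n → EReal} {u : Vn n → EReal} (h : EpiConverges uk u)
    (hk : ∀ k, uk k ∈ ConvSc n) (hu : u ∈ ConvSc n) (C : ℝ) :
    ∃ R : ℕ, ∀ᶠ k in atTop, ∀ x p, ‖p‖ ≤ C → x ∈ dm (uk k) → Sub (uk k) x p → ‖x‖ ≤ R := by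
  by_contra! hcon
  obtain ⟨φ, hφ, hP⟩ := extraction_forall_of_frequently hcon
  choose x p hpC hx hs hxR using hP
  have hE := epi_subseq h hφ
  obtain ⟨⟨-, -, hb, y0, hy0⟩, hsc⟩ := hu
  obtain ⟨y, c, hy, hc, hle⟩ := epi_rec hE hb hy0
  have hC : 0 ≤ C := (norm_nonneg _).trans (hpC 0)
  have hxinf : Tendsto (fun j => ‖x j‖) atTop atTop :=
    tendsto_atTop_mono (fun j => (hxR j).le) tendsto_natCast_atTop_atTop
  have hdinf : Tendsto (fun j => ‖x j - y j‖) atTop atTop := by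
    have h1 : Tendsto (fun j => ‖x j‖ + -‖y j‖) atTop atTop :=
      hxinf.atTop_add hy.norm.neg
    refine tendsto_atTop_mono (fun j => ?_) h1
    have := norm_sub_norm_le (x j) (y j); linarith
  let e : ℕ → Vn n := fun j => (‖x j - y j‖)⁻¹ • (x j - y j)
  have he1 : ∀ j, ‖e j‖ ≤ 1 := by
    intro j
    simp only [e, norm_smul, norm_inv, norm_norm]
    exact inv_mul_le_one
  obtain ⟨e0, -, ψ, hψ, hψe⟩ := (isCompact_closedBall (0 : Vn n) 1).tendsto_subseq
    (fun j => by simpa using he1 j)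
  have he0 : ‖e0‖ = 1 := by
    refine tendsto_nhds_unique hψe.norm (tendsto_const_nhds.congr' ?_)
    filter_upwards [hψ.tendsto_atTop.eventually (hdinf.eventually_gt_atTop 0)] with j hj
    simp [e, norm_smul, inv_mul_cancel₀ hj.ne']
  have hE2 := epi_subseq hE hψ
  have key : ∀ R : ℝ, 0 < R → u (y0 + R • e0) ≤ ((rl u y0 + C * R : ℝ) : EReal) := by
    intro R hR
    refine epi_le hE2 (x := fun j => y (ψ j) + R • e (ψ j)) (c := fun j => c (ψ j) + C * R)
      ((hy.comp hψ.tendsto_atTop).add (hψe.const_smul R))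
      ((hc.comp hψ.tendsto_atTop).add_const _) ?_
    filter_upwards [hψ.tendsto_atTop.eventually (hdinf.eventually_gt_atTop R),
      hψ.tendsto_atTop.eventually hle] with j hj hj2
    set i := ψ j
    have hD : 0 < ‖x i - y i‖ := hR.trans hj
    have h1 := (hs i).le hj2
    have hbk := (hk (φ i)).1.2.2.1
    have h4 : |inner ℝ (p i) (y i - x i)| ≤ C * ‖x i - y i‖ := by
      rw [norm_sub_rev]
      exact (abs_real_inner_le_norm _ _).trans (mul_le_mul_of_nonneg_right (hpC i) (norm_nonneg _))
    have h5 := (abs_le.1 h4).1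
    have h6 : uk (φ i) (x i) ≤ ((c i + C * ‖x i - y i‖ : ℝ) : EReal) := by
      rw [← coe_rl hbk (hx i)]
      exact_mod_cast (by linarith : rl (uk (φ i)) (x i) ≤ c i + C * ‖x i - y i‖)
    have h7 := cvx_epi (hk (φ i)).1.1 (t := R / ‖x i - y i‖) (by positivity)
      ((div_lt_one hD).2 hj) h6 hj2
    have e1 : (R / ‖x i - y i‖) • x i + (1 - R / ‖x i - y i‖) • y i = y i + R • e i := by
      simp only [e, smul_smul, div_eq_mul_inv]
      module
    have e2 : (R / ‖x i - y i‖) * (c i + C * ‖x i - y i‖) + (1 - R / ‖x i - y i‖) * c i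
        = c i + C * R := by
      field_simp; ring
    rw [e1, e2] at h7
    exact h7
  obtain ⟨R, hR⟩ := hsc (C + 1)
  obtain ⟨T, hT⟩ := exists_gt (max (max 0 (R + ‖y0‖)) (rl u y0 + (C + 1) * ‖y0‖))
  simp only [max_lt_iff] at hT
  have h1 : T - ‖y0‖ ≤ ‖y0 + T • e0‖ := by
    have := norm_sub_norm_le (T • e0) (-y0)
    rw [norm_smul, he0, norm_neg, Real.norm_of_nonneg hT.1.1.le, sub_neg_eq_add, add_comm (T • e0)] at this
    linarith
  have h2 := (hR (y0 + T • e0) (by linarith)).trans (key T hT.1.1)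
  have h2 : (C + 1) * ‖y0 + T • e0‖ ≤ rl u y0 + C * T := by exact_mod_cast h2
  nlinarith

theorem grad_limit {uk : ℕ → Vn n → EReal} {u : Vn n → EReal} (h : EpiConverges uk u)
    (hk : ∀ k, uk k ∈ ConvSc n) (hu : u ∈ ConvSc n) {x0 : Vn n} (hg : ∀ k, Good (uk k) x0)
    (hx : x0 ∈ interior (dm u)) (hd : DifferentiableAt ℝ (rl u) x0) :
    (∀ᶠ k in atTop, x0 ∈ interior (dm (uk k))) ∧
    Tendsto (fun k => gradient (rl (uk k)) x0) atTop (𝓝 (gradient (rl u) x0)) := by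
  obtain ⟨⟨-, -, hb, hne⟩, -⟩ := id hu
  obtain ⟨δ, hδ, hball⟩ := Metric.isOpen_iff.1 isOpen_interior x0 hx
  have hpt : ∀ e : Vn n, ‖e‖ = 1 → x0 + (δ / 2) • e ∈ dm u := by
    intro e he
    apply interior_subset; apply hball
    simp [norm_smul, he, abs_of_pos hδ]
    linarith
  have hB1 : ∀ᶠ k in atTop, x0 ∈ interior (dm (uk k)) := by
    by_contra hcon
    obtain ⟨φ, hφ, hP⟩ := extraction_of_frequently_atTop (not_eventually.1 hcon)
    have hE := epi_subseq h hφ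
    have hsep : ∀ j, ∃ e : Vn n, ‖e‖ = 1 ∧ ∀ y ∈ dm (uk (φ j)), inner ℝ e (y - x0) ≤ 0 := by
      intro j
      have hcl : x0 ∉ closure (dm (uk (φ j))) := by
        rcases hg (φ j) with h1 | h1
        · exact absurd h1.1 (hP j)
        · exact h1
      have hcv := convex_dm (hk (φ j)).1.1 (hk (φ j)).1.2.2.1
      obtain ⟨f, a, h1, h2⟩ := geometric_hahn_banach_closed_point hcv.closure isClosed_closure hcl
      obtain ⟨z, hz⟩ := (hk (φ j)).1.2.2.2
      set e := (InnerProductSpace.toDual ℝ (Vn n)).symm f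
      have hef : ∀ y, inner ℝ e y = f y := fun y => InnerProductSpace.toDual_symm_apply
      have hlt : ∀ y ∈ dm (uk (φ j)), inner ℝ e (y - x0) < 0 := by
        intro y hy
        rw [hef, map_sub]
        linarith [h1 y (subset_closure hy)]
      have he : e ≠ 0 := by
        intro h0
        have := hlt z hz
        simp [h0] at this
      refine ⟨‖e‖⁻¹ • e, by rw [norm_smul, norm_inv, norm_norm, inv_mul_cancel₀ (norm_ne_zero_iff.2 he)], ?_⟩
      intro y hy
      rw [real_inner_smul_left]
      exact mul_nonpos_of_nonneg_of_nonpos (by positivity) (hlt y hy).le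
    choose e he1 he2 using hsep
    obtain ⟨e0, he0, ψ, hψ, hψe⟩ := (isCompact_sphere (0 : Vn n) 1).tendsto_subseq
      (fun j => by simpa using he1 j)
    have he0 : ‖e0‖ = 1 := by simpa using he0
    obtain ⟨y, c, hy, hc, hle⟩ := epi_rec (epi_subseq hE hψ) hb (hpt e0 he0)
    have h1 : Tendsto (fun j => inner ℝ (e (ψ j)) (y j - x0)) atTop
        (𝓝 (inner ℝ e0 (x0 + (δ / 2) • e0 - x0))) := hψe.inner (hy.sub_const x0)
    have h2 := le_of_tendsto h1 (b := 0) (by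
      filter_upwards [hle] with j hj
      exact he2 (ψ j) _ (hj.trans_lt (EReal.coe_lt_top _)).ne)
    rw [add_sub_cancel_left, real_inner_smul_right, real_inner_self_eq_norm_sq, he0] at h2
    linarith
  have hgood : ∀ᶠ k in atTop, x0 ∈ interior (dm (uk k)) ∧ Sub (uk k) x0 (gradient (rl (uk k)) x0) := by
    filter_upwards [hB1] with k hk1
    refine ⟨hk1, ?_⟩
    have hdk : DifferentiableAt ℝ (rl (uk k)) x0 := by
      rcases hg k with h1 | h1
      · exact h1.2
      · exact absurd (subset_closure (interior_subset hk1)) h1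
    exact subgrad (hk k).1.1 (hk k).1.2.2.1 (interior_subset hk1) hdk
  have hlow : ∀ᶠ k in atTop, ((rl u x0 - 1 : ℝ) : EReal) < uk k x0 := by
    refine eventually_lt_of_lt_liminf (lt_of_lt_of_le ?_ ((h x0).1 (fun _ => x0) tendsto_const_nhds))
    rw [← coe_rl hb (interior_subset hx)]
    exact_mod_cast (by linarith : rl u x0 - 1 < rl u x0)
  have hB2 : ∃ C : ℕ, ∀ᶠ k in atTop, ‖gradient (rl (uk k)) x0‖ ≤ C := by
    by_contra! hcon
    have hcon2 : ∀ C : ℕ, ∃ᶠ k in atTop, (C : ℝ) < ‖gradient (rl (uk k)) x0‖ ∧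
      (x0 ∈ interior (dm (uk k)) ∧ Sub (uk k) x0 (gradient (rl (uk k)) x0)) ∧ 
        ((rl u x0 - 1 : ℝ) : EReal) < uk k x0 := fun C => ((hcon C).and_eventually (hgood.and hlow))
    obtain ⟨φ, hφ, hP⟩ := extraction_forall_of_frequently hcon2
    have hE := epi_subseq h hφ
    set p : ℕ → Vn n := fun j => gradient (rl (uk (φ j))) x0 with hpdef
    have hpinf : Tendsto (fun j => ‖p j‖) atTop atTop :=
      tendsto_atTop_mono (fun j => (hP j).1.le) tendsto_natCast_atTop_atTop
    have hp0 : ∀ j, 0 < ‖p j‖ := fun j => (Nat.cast_nonneg j).trans_lt (hP j).1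
    obtain ⟨e0, he0, ψ, hψ, hψe⟩ := (isCompact_sphere (0 : Vn n) 1).tendsto_subseq
      (x := fun j => ‖p j‖⁻¹ • p j)
      (fun j => by simp [norm_smul, inv_mul_cancel₀ (hp0 j).ne'])
    have he0 : ‖e0‖ = 1 := by simpa using he0
    obtain ⟨y, c, hy, hc, hle⟩ := epi_rec (epi_subseq hE hψ) hb (hpt e0 he0)
    have h1 : Tendsto (fun j => inner ℝ (‖p (ψ j)‖⁻¹ • p (ψ j)) (y j - x0)) atTop
        (𝓝 (inner ℝ e0 (x0 + (δ / 2) • e0 - x0))) := hψe.inner (hy.sub_const x0)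
    have h2 : Tendsto (fun j => ‖p (ψ j)‖⁻¹ * (c j - (rl u x0 - 1))) atTop (𝓝 (0 * _)) :=
      ((tendsto_inv_atTop_zero.comp hpinf).comp hψ.tendsto_atTop).mul (hc.sub_const _)
    have h3 := le_of_tendsto_of_tendsto h1 h2 (by
      filter_upwards [hle] with j hj
      rw [real_inner_smul_left]
      refine mul_le_mul_of_nonneg_left ?_ (by positivity)
      have h4 := (hP (ψ j)).2.1.2.le hj
      have h5 := (hP (ψ j)).2.2
      rw [← coe_rl (hk _).1.2.2.1 (interior_subset (hP (ψ j)).2.1.1)] at h5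
      have h5 : rl u x0 - 1 < rl (uk (φ (ψ j))) x0 := by exact_mod_cast h5
      linarith)
    rw [add_sub_cancel_left, real_inner_smul_right, real_inner_self_eq_norm_sq, he0] at h3
    linarith
  refine ⟨hB1, ?_⟩
  obtain ⟨C, hC⟩ := hB2
  by_contra hcon
  obtain ⟨U, hU, hfr⟩ := not_tendsto_iff_exists_frequently_notMem.1 hcon
  obtain ⟨φ, hφ, hP⟩ := extraction_of_frequently_atTop (hfr.and_eventually (hC.and hgood))
  obtain ⟨q, -, ψ, hψ, hψq⟩ := (isCompact_closedBall (0 : Vn n) C).tendsto_subseq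
    (x := fun j => gradient (rl (uk (φ j))) x0) (fun j => by simpa using (hP j).2.1)
  have hs := sub_limit (epi_subseq (epi_subseq h hφ) hψ) (fun k => (hk _).1.2.2.1) hb hne
    (fun j => interior_subset (hP (ψ j)).2.2.1) (fun j => (hP (ψ j)).2.2.2) hψq
  have := subgrad_unique hb hx hd hs.2
  rw [this] at hU
  obtain ⟨j, hj⟩ := (hψq.eventually hU).exists
  exact (hP (ψ j)).1 hj

end Cl


namespace Cl
variable {n : ℕ}

/-- integrand `ζ(∇u)` on the interior of the domain, zero elsewhere -/
def Fz (ζ : Vn n → ℝ) (u : Vn n → EReal) : Vn n → ℝ :=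
  (interior (dm u)).indicator (fun x => ζ (gradient (rl u) x))

theorem measurable_grad (f : Vn n → ℝ) : Measurable (gradient f) :=
  ((InnerProductSpace.toDual ℝ (Vn n)).symm.continuous.measurable).comp (measurable_fderiv ℝ f)

theorem Fz_measurable {ζ : Vn n → ℝ} (hζ : Continuous ζ) (u : Vn n → EReal) :
    Measurable (Fz ζ u) :=
  (hζ.measurable.comp (measurable_grad _)).indicator isOpen_interior.measurableSet

theorem int_eq {u : Vn n → EReal} (hu : IsConvexFn u) (hb : ∀ x, u x ≠ ⊥) (ζ : Vn n → ℝ) :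
    ∫ x in {x : Vn n | u x ≠ ⊤}, ζ (gradient (fun y => (u y).toReal) x) = ∫ x, Fz ζ u x := by
  rw [Fz, integral_indicator isOpen_interior.measurableSet]
  refine setIntegral_congr_set ?_
  filter_upwards [ae_good hu hb] with x hx
  apply propext
  change x ∈ dm u ↔ x ∈ interior (dm u)
  refine ⟨fun h => ?_, fun h => interior_subset h⟩
  rcases hx with h1 | h1
  · exact h1.1
  · exact absurd (subset_closure h) h1

theorem Fz_congr {u v : Vn n → EReal} {x : Vn n} (h : u =ᶠ[𝓝 x] v) (ζ : Vn n → ℝ) :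
    Fz ζ u x = Fz ζ v x := by
  have h1 : rl u =ᶠ[𝓝 x] rl v := h.mono fun y hy => by simp [rl, hy]
  have h2 : x ∈ interior (dm u) ↔ x ∈ interior (dm v) := by
    simp only [mem_interior_iff_mem_nhds]
    refine ⟨fun hh => ?_, fun hh => ?_⟩
    · filter_upwards [hh, h] with y a b
      rw [dm, Set.mem_ofPred_eq, ← b]; exact a
    · filter_upwards [hh, h] with y a b
      rw [dm, Set.mem_ofPred_eq, b]; exact a
  by_cases hx : x ∈ interior (dm u)
  · rw [Fz, Fz, Set.indicator_of_mem hx, Set.indicator_of_mem (h2.1 hx), h1.gradient_eq]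
  · rw [Fz, Fz, Set.indicator_of_notMem hx, Set.indicator_of_notMem (fun h => hx (h2.2 h))]

theorem Fz_out {u : Vn n → EReal} {x : Vn n} (h : x ∉ closure (dm u)) (ζ : Vn n → ℝ) :
    Fz ζ u x = 0 :=
  Set.indicator_of_notMem (fun hh => h (subset_closure (interior_subset hh))) _

theorem Fz_ne {u : Vn n → EReal} {x : Vn n} (hu : u ∈ ConvSc n) (hg : Good u x) {ζ : Vn n → ℝ}
    (h : Fz ζ u x ≠ 0) : x ∈ interior (dm u) ∧ Sub u x (gradient (rl u) x) ∧
      ζ (gradient (rl u) x) ≠ 0 := by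
  by_cases hx : x ∈ interior (dm u)
  · refine ⟨hx, ?_, ?_⟩
    · rcases hg with h1 | h1
      · exact subgrad hu.1.1 hu.1.2.2.1 (interior_subset hx) h1.2
      · exact absurd (subset_closure (interior_subset hx)) h1
    · rwa [Fz, Set.indicator_of_mem hx] at h
  · exact absurd (Set.indicator_of_notMem hx _) h

theorem supp_bdd {ζ : Vn n → ℝ} (hc : HasCompactSupport ζ) : ∃ C : ℝ, ∀ p, ζ p ≠ 0 → ‖p‖ ≤ C := by
  obtain ⟨C, hC⟩ := hc.isBounded.exists_norm_le
  exact ⟨C, fun p hp => hC p (subset_tsupport ζ hp)⟩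

theorem Fz_le {ζ : Vn n → ℝ} {M : ℝ} (hM : ∀ p, ‖ζ p‖ ≤ M) (u : Vn n → EReal) (x : Vn n) :
    ‖Fz ζ u x‖ ≤ M := by
  by_cases hx : x ∈ interior (dm u)
  · rw [Fz, Set.indicator_of_mem hx]; exact hM _
  · rw [Fz, Set.indicator_of_notMem hx]; simpa using (norm_nonneg _).trans (hM 0)

theorem Fz_supp {u : Vn n → EReal} (hu : u ∈ ConvSc n) {ζ : Vn n → ℝ} (hc : HasCompactSupport ζ) :
    ∃ R : ℝ, ∀ x, Good u x → Fz ζ u x ≠ 0 → ‖x‖ ≤ R := by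
  obtain ⟨C, hC⟩ := supp_bdd hc
  obtain ⟨R, hR⟩ := sub_bdd hu C
  exact ⟨R, fun x hg hx => by
    obtain ⟨h1, h2, h3⟩ := Fz_ne hu hg hx
    exact hR x _ (hC _ h3) (interior_subset h1) h2⟩

theorem integrable_bd (R M : ℝ) :
    Integrable ((Metric.closedBall (0 : Vn n) R).indicator (fun _ => M)) :=
  (integrable_indicator_iff Metric.isClosed_closedBall.measurableSet).2
    (integrableOn_const (isCompact_closedBall _ _).measure_lt_top.ne)

theorem Fz_bound {ζ : Vn n → ℝ} {M R : ℝ} (hM : ∀ p, ‖ζ p‖ ≤ M) {u : Vn n → EReal} {x : Vn n}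
    (h : Fz ζ u x ≠ 0 → ‖x‖ ≤ R) :
    ‖Fz ζ u x‖ ≤ (Metric.closedBall (0 : Vn n) R).indicator (fun _ => M) x := by
  by_cases hx : x ∈ Metric.closedBall (0 : Vn n) R
  · rw [Set.indicator_of_mem hx]; exact Fz_le hM u x
  · rw [Set.indicator_of_notMem hx]
    by_cases h0 : Fz ζ u x = 0
    · simp [h0]
    · exact absurd (by simpa using h h0) hx

theorem Fz_integrable {u : Vn n → EReal} (hu : u ∈ ConvSc n) {ζ : Vn n → ℝ} (hζ : Continuous ζ)
    (hc : HasCompactSupport ζ) : Integrable (Fz ζ u) := by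
  obtain ⟨M, hM⟩ := hζ.bounded_above_of_compact_support hc
  obtain ⟨R, hR⟩ := Fz_supp hu hc
  refine (integrable_bd R M).mono' (Fz_measurable hζ u).aestronglyMeasurable ?_
  filter_upwards [ae_good hu.1.1 hu.1.2.2.1] with x hx
  exact Fz_bound hM (hR x hx)

theorem Fz_tendsto {uk : ℕ → Vn n → EReal} {u : Vn n → EReal} (h : EpiConverges uk u)
    (hk : ∀ k, uk k ∈ ConvSc n) (hu : u ∈ ConvSc n) {ζ : Vn n → ℝ} (hζ : Continuous ζ)
    (hc : HasCompactSupport ζ) {x0 : Vn n} (hg : ∀ k, Good (uk k) x0) (hgu : Good u x0) :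
    Tendsto (fun k => Fz ζ (uk k) x0) atTop (𝓝 (Fz ζ u x0)) := by
  rcases hgu with hgu | hgu
  · obtain ⟨h1, h2⟩ := grad_limit h hk hu hg hgu.1 hgu.2
    rw [Fz, Set.indicator_of_mem hgu.1]
    refine ((hζ.tendsto _).comp h2).congr' ?_
    filter_upwards [h1] with k hk1
    rw [Fz, Set.indicator_of_mem hk1]; rfl
  · rw [Fz_out hgu]
    refine tendsto_const_nhds.congr' ?_
    by_contra hcon
    obtain ⟨φ, hφ, hP⟩ := extraction_of_frequently_atTop (not_eventually.1 hcon)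
    obtain ⟨C, hC⟩ := supp_bdd hc
    have hP' := fun j => Fz_ne (hk (φ j)) (hg (φ j)) (ζ := ζ) (fun h0 => hP j h0.symm)
    obtain ⟨q, -, ψ, hψ, hψq⟩ := (isCompact_closedBall (0 : Vn n) C).tendsto_subseq
      (x := fun j => gradient (rl (uk (φ j))) x0) (fun j => by simpa using hC _ (hP' j).2.2)
    have hs := sub_limit (epi_subseq (epi_subseq h hφ) hψ) (fun k => (hk _).1.2.2.1) hu.1.2.2.1
      hu.1.2.2.2
      (fun j => interior_subset (hP' (ψ j)).1) (fun j => (hP' (ψ j)).2.1) hψq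
    exact hgu (subset_closure hs.1)

theorem int_continuous {ζ : Vn n → ℝ} (hζ : Continuous ζ) (hc : HasCompactSupport ζ) :
    ContinuousVal (ConvSc n) (fun u => ∫ x, Fz ζ u x) := by
  intro uk u hk hu h
  obtain ⟨M, hM⟩ := hζ.bounded_above_of_compact_support hc
  obtain ⟨C, hC⟩ := supp_bdd hc
  obtain ⟨R, hR⟩ := sub_equibdd h hk hu C
  have hgk : ∀ᵐ x, ∀ k, Good (uk k) x := ae_all_iff.2 fun k => ae_good (hk k).1.1 (hk k).1.2.2.1
  refine tendsto_integral_filter_of_dominated_convergence _ 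
    (Eventually.of_forall fun k => (Fz_measurable hζ _).aestronglyMeasurable) ?_
    (integrable_bd (R : ℝ) M) ?_
  · filter_upwards [hR] with k hRk
    filter_upwards [hgk] with x hx
    refine Fz_bound hM (fun h0 => ?_)
    obtain ⟨h1, h2, h3⟩ := Fz_ne (hk k) (hx k) h0
    exact hRk x _ (hC _ h3) (interior_subset h1) h2
  · filter_upwards [hgk, ae_good hu.1.1 hu.1.2.2.1] with x hx hx2
    exact Fz_tendsto h hk hu hζ hc hx hx2

theorem grad_eq_of_le {f g : Vn n → ℝ} {x : Vn n} (hf : DifferentiableAt ℝ f x)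
    (hg : DifferentiableAt ℝ g x) (h : f ≤ᶠ[𝓝 x] g) (hx : f x = g x) :
    gradient f x = gradient g x := by
  have hm : IsLocalMin (g - f) x := by
    filter_upwards [h] with y hy
    simp [hx]; linarith
  have := hm.fderiv_eq_zero
  rw [fderiv_sub hg hf, sub_eq_zero] at this
  simp [gradient, this]

theorem Fz_val_pt {u v : Vn n → EReal} (hub : ∀ x, u x ≠ ⊥) (hvb : ∀ x, v x ≠ ⊥) {x : Vn n}
    (h1 : Good u x) (h2 : Good v x) (h3 : Good (u ⊔ v) x) (h4 : Good (u ⊓ v) x) (ζ : Vn n → ℝ) :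
    Fz ζ (u ⊔ v) x + Fz ζ (u ⊓ v) x = Fz ζ u x + Fz ζ v x := by
  have hsup : dm (u ⊔ v) = dm u ∩ dm v := by
    ext y; simp [dm, max_eq_top]
  have hinf : dm (u ⊓ v) = dm u ∪ dm v := by
    ext y; simp only [dm, Set.mem_ofPred_eq, Pi.inf_apply, ne_eq, min_eq_top, Set.mem_union]; tauto
  have out : ∀ {w : Vn n → EReal}, x ∉ closure (dm w) → ∀ᶠ y in 𝓝 x, w y = ⊤ := by
    intro w hw
    filter_upwards [isClosed_closure.isOpen_compl.mem_nhds hw] with y hy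
    by_contra hc
    exact hy (subset_closure hc)
  have c1 : x ∉ closure (dm u) → Fz ζ (u ⊔ v) x + Fz ζ (u ⊓ v) x = Fz ζ u x + Fz ζ v x := by
    intro hu
    rw [Fz_congr (u := u ⊔ v) (v := u), Fz_congr (u := u ⊓ v) (v := v)]
    · filter_upwards [out hu] with y hy; simp [hy]
    · filter_upwards [out hu] with y hy; simp [hy]
  have c2 : x ∉ closure (dm v) → Fz ζ (u ⊔ v) x + Fz ζ (u ⊓ v) x = Fz ζ u x + Fz ζ v x := by
    intro hu
    rw [Fz_congr (u := u ⊔ v) (v := v), Fz_congr (u := u ⊓ v) (v := u), add_comm]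
    · filter_upwards [out hu] with y hy; simp [hy]
    · filter_upwards [out hu] with y hy; simp [hy]
  rcases h1 with ⟨h1, h1d⟩ | h1
  swap
  · exact c1 h1
  rcases h2 with ⟨h2, h2d⟩ | h2
  swap
  · exact c2 h2
  have i3 : x ∈ interior (dm (u ⊔ v)) := by rw [hsup, interior_inter]; exact ⟨h1, h2⟩
  have i4 : x ∈ interior (dm (u ⊓ v)) := by
    rw [hinf]; exact interior_mono Set.subset_union_left h1
  have d3 : DifferentiableAt ℝ (rl (u ⊔ v)) x := by
    rcases h3 with h | h
    · exact h.2
    · exact absurd (subset_closure (interior_subset i3)) h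
  have d4 : DifferentiableAt ℝ (rl (u ⊓ v)) x := by
    rcases h4 with h | h
    · exact h.2
    · exact absurd (subset_closure (interior_subset i4)) h
  have n1 := mem_interior_iff_mem_nhds.1 h1
  have n2 := mem_interior_iff_mem_nhds.1 h2
  have lt_iff : ∀ {y}, y ∈ dm u → y ∈ dm v → ((rl u y < rl v y ↔ u y < v y) ∧ (rl v y < rl u y ↔ v y < u y)) := by
    intro y a b
    rw [← coe_rl hub a, ← coe_rl hvb b]; simp
  rcases lt_trichotomy (rl u x) (rl v x) with hlt | heq | hlt
  · have ev : ∀ᶠ y in 𝓝 x, u y < v y := by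
      filter_upwards [n1, n2, h1d.continuousAt.eventually_lt h2d.continuousAt hlt] with y a b c
      exact (lt_iff a b).1.1 c
    rw [Fz_congr (u := u ⊔ v) (v := v), Fz_congr (u := u ⊓ v) (v := u), add_comm]
    · filter_upwards [ev] with y hy; simp [hy.le]
    · filter_upwards [ev] with y hy; simp [hy.le]
  · have hmm : ∀ {y}, y ∈ dm u → y ∈ dm v → rl (u ⊔ v) y = max (rl u y) (rl v y) ∧
        rl (u ⊓ v) y = min (rl u y) (rl v y) := by
      intro y a b
      rcases le_total (u y) (v y) with c | c
      · have c' : rl u y ≤ rl v y := EReal.toReal_le_toReal c (hub y) b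
        simp [rl, max_eq_right c, min_eq_left c] at c' ⊢; exact c'
      · have c' : rl v y ≤ rl u y := EReal.toReal_le_toReal c (hvb y) a
        simp [rl, max_eq_left c, min_eq_right c] at c' ⊢; exact c'
    have hx := hmm (interior_subset h1) (interior_subset h2)
    have g4u : gradient (rl (u ⊓ v)) x = gradient (rl u) x :=
      grad_eq_of_le d4 h1d (by filter_upwards [n1, n2] with y a b; rw [(hmm a b).2]; exact min_le_left _ _)
        (by rw [hx.2, heq, min_self])
    have g4v : gradient (rl (u ⊓ v)) x = gradient (rl v) x :=
      grad_eq_of_le d4 h2d (by filter_upwards [n1, n2] with y a b; rw [(hmm a b).2]; exact min_le_right _ _)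
        (by rw [hx.2, heq, min_self])
    have g3 : gradient (rl u) x = gradient (rl (u ⊔ v)) x :=
      grad_eq_of_le h1d d3 (by filter_upwards [n1, n2] with y a b; rw [(hmm a b).1]; exact le_max_left _ _)
        (by rw [hx.1, heq, max_self])
    simp only [Fz, Set.indicator_of_mem h1, Set.indicator_of_mem h2, Set.indicator_of_mem i3,
      Set.indicator_of_mem i4]
    rw [← g3, ← g4v, g4u]
  · have ev : ∀ᶠ y in 𝓝 x, v y < u y := by
      filter_upwards [n1, n2, h2d.continuousAt.eventually_lt h1d.continuousAt hlt] with y a b c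
      exact (lt_iff a b).2.1 c
    rw [Fz_congr (u := u ⊔ v) (v := u), Fz_congr (u := u ⊓ v) (v := v)]
    · filter_upwards [ev] with y hy; simp [hy.le]
    · filter_upwards [ev] with y hy; simp [hy.le]

theorem int_valuation {ζ : Vn n → ℝ} (hζ : Continuous ζ) (hc : HasCompactSupport ζ) :
    IsValuation (ConvSc n) (fun u => ∫ x, Fz ζ u x) := by
  intro u v hu hv h3 h4
  have g : ∀ {w : Vn n → EReal}, w ∈ ConvSc n → ∀ᵐ x, Good w x := fun hw => ae_good hw.1.1 hw.1.2.2.1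
  simp only
  rw [← integral_add (Fz_integrable h3 hζ hc) (Fz_integrable h4 hζ hc),
    ← integral_add (Fz_integrable hu hζ hc) (Fz_integrable hv hζ hc)]
  refine integral_congr_ae ?_
  filter_upwards [g hu, g hv, g h3, g h4] with x a b c d
  exact Fz_val_pt hu.1.2.2.1 hv.1.2.2.1 a b c d ζ

theorem int_transl (ζ : Vn n → ℝ) :
    EpiTranslationInvariant (ConvSc n) (fun u => ∫ x, Fz ζ u x) := by
  intro u hu x₀ c
  simp only
  rw [← integral_sub_right_eq_self (Fz ζ u) x₀]
  refine integral_congr_ae (Eventually.of_forall fun x => ?_)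
  simp only
  have hd : dm (fun x => u (x - x₀) + (c : EReal)) = (fun x => x - x₀) ⁻¹' dm u := by
    ext y
    simp only [dm, Set.mem_ofPred_eq, Set.mem_preimage, ne_eq, not_iff_not]
    constructor
    · intro h
      by_contra hne
      rw [← coe_rl hu.1.2.2.1 (x := y - x₀) hne, ← EReal.coe_add] at h
      exact EReal.coe_ne_top _ h
    · intro h; rw [h]; simp
  have hi : interior (dm (fun x => u (x - x₀) + (c : EReal))) = (fun x => x - x₀) ⁻¹' interior (dm u) := by
    rw [hd]; exact ((Homeomorph.subRight x₀).preimage_interior _).symm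
  by_cases hx : x - x₀ ∈ interior (dm u)
  · have hx' : x ∈ interior (dm (fun x => u (x - x₀) + (c : EReal))) := by rw [hi]; exact hx
    rw [Fz, Fz, Set.indicator_of_mem hx, Set.indicator_of_mem hx']
    congr 1
    have : rl (fun x => u (x - x₀) + (c : EReal)) =ᶠ[𝓝 x] fun y => rl u (y - x₀) + c := by
      filter_upwards [mem_interior_iff_mem_nhds.1 hx'] with y hy
      rw [hd] at hy
      have hy : u (y - x₀) ≠ ⊤ := hy
      simp only [rl]
      rw [EReal.toReal_add hy (hu.1.2.2.1 _) (EReal.coe_ne_top _) (EReal.coe_ne_bot _)]; simp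
    rw [this.gradient_eq]
    simp [gradient, fderiv_comp_sub]
  · have hx' : x ∉ interior (dm (fun x => u (x - x₀) + (c : EReal))) := by rw [hi]; exact hx
    rw [Fz, Fz, Set.indicator_of_notMem hx, Set.indicator_of_notMem hx']

theorem dm_epiMul {u : Vn n → EReal} (hb : ∀ x, u x ≠ ⊥) {l : ℝ} (hl : 0 < l) :
    dm (epiMul l u) = (fun x => l⁻¹ • x) ⁻¹' dm u := by
  ext y
  simp only [dm, Set.mem_ofPred_eq, Set.mem_preimage, ne_eq, not_iff_not, epiMul, hl.ne', if_false]
  constructor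
  · intro h
    by_contra hne
    rw [← coe_rl hb (x := l⁻¹ • y) hne, ← EReal.coe_mul] at h
    exact EReal.coe_ne_top _ h
  · intro h; rw [h, EReal.coe_mul_top_of_pos hl]

theorem int_homog (ζ : Vn n → ℝ) :
    EpiHomogeneous (ConvSc n) (fun u => ∫ x, Fz ζ u x) n := by
  intro u hu l hl
  simp only
  have key : ∀ x, Fz ζ (epiMul l u) x = Fz ζ u (l⁻¹ • x) := by
    intro x
    have hi : interior (dm (epiMul l u)) = (fun x => l⁻¹ • x) ⁻¹' interior (dm u) := by
      rw [dm_epiMul hu.1.2.2.1 hl]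
      exact ((Homeomorph.smulOfNeZero l⁻¹ (inv_ne_zero hl.ne')).preimage_interior _).symm
    have hg : gradient (rl (epiMul l u)) x = gradient (rl u) (l⁻¹ • x) := by
      have : rl (epiMul l u) = l • (fun y => rl u (l⁻¹ • y)) := by
        funext y; simp [rl, epiMul, hl.ne', EReal.toReal_mul]
      rw [this, gradient, fderiv_const_smul_field, Pi.smul_apply, fderiv_comp_smul, smul_smul,
        mul_inv_cancel₀ hl.ne', one_smul]; rfl
    by_cases hx : l⁻¹ • x ∈ interior (dm u)
    · have hx' : x ∈ interior (dm (epiMul l u)) := by rw [hi]; exact hx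
      rw [Fz, Fz, Set.indicator_of_mem hx, Set.indicator_of_mem hx', hg]
    · have hx' : x ∉ interior (dm (epiMul l u)) := by rw [hi]; exact hx
      rw [Fz, Fz, Set.indicator_of_notMem hx, Set.indicator_of_notMem hx']
  simp only [key]
  rw [Measure.integral_comp_inv_smul_of_nonneg volume (Fz ζ u) hl.le]
  simp

end Cl


namespace Cl
variable {n : ℕ}

theorem lsc_of_real {u : Vn n → EReal} (hb : ∀ x, u x ≠ ⊥)
    (h : ∀ a : ℝ, IsClosed {x | u x ≤ (a : EReal)}) : LowerSemicontinuous u := by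
  rw [lowerSemicontinuous_iff_isClosed_preimage]
  intro y
  induction y using EReal.rec with
  | bot =>
    have : u ⁻¹' Set.Iic ⊥ = ∅ := by
      ext x; simp [hb x]
    rw [this]; exact isClosed_empty
  | coe a => exact h a
  | top =>
    have : u ⁻¹' Set.Iic ⊤ = Set.univ := by ext x; simp
    rw [this]; exact isClosed_univ

theorem lsc_real {u : Vn n → EReal} (h : LowerSemicontinuous u) (a : ℝ) :
    IsClosed {x | u x ≤ (a : EReal)} := lowerSemicontinuous_iff_isClosed_preimage.1 h a

theorem add_coe_le {z : EReal} {c a : ℝ} : z + (c : EReal) ≤ (a : EReal) ↔ z ≤ ((a - c : ℝ) : EReal) := by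
  induction z using EReal.rec with
  | bot => simp
  | coe r => norm_cast; constructor <;> intro h <;> linarith
  | top =>
    rw [EReal.top_add_coe, top_le_iff, top_le_iff]
    simp only [EReal.coe_ne_top]
theorem mul_coe_le {z : EReal} {l a : ℝ} (hl : 0 < l) :
    (l : EReal) * z ≤ (a : EReal) ↔ z ≤ ((l⁻¹ * a : ℝ) : EReal) := by
  induction z using EReal.rec with
  | bot => simp [EReal.coe_mul_bot_of_pos hl]
  | coe r =>
    norm_cast
    rw [← div_eq_inv_mul, le_div_iff₀ hl, mul_comm]
  | top =>
    rw [EReal.coe_mul_top_of_pos hl, top_le_iff, top_le_iff]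
    simp only [EReal.coe_ne_top]

theorem transl_mem {u : Vn n → EReal} (hu : u ∈ ConvSc n) (x₀ : Vn n) (c : ℝ) :
    (fun x => u (x - x₀) + (c : EReal)) ∈ ConvSc n := by
  obtain ⟨⟨h1, h2, hb, z, hz⟩, h3⟩ := hu
  have hb' : ∀ x, u (x - x₀) + (c : EReal) ≠ ⊥ := by
    intro x
    simp [EReal.add_eq_bot_iff, hb]
  refine ⟨⟨of_epi hb' ?_, lsc_of_real hb' ?_, hb', z + x₀, ?_⟩, ?_⟩
  · intro x y t a b ht0 ht1 ha hb
    have h4 := cvx_epi h1 ht0 ht1 (add_coe_le.1 ha.le) (add_coe_le.1 hb.le)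
    have e : t • x + (1 - t) • y - x₀ = t • (x - x₀) + (1 - t) • (y - x₀) := by module
    rw [add_coe_le, e]
    refine h4.trans (le_of_eq ?_)
    congr 1; ring
  · intro a
    simp only [add_coe_le]
    exact (lsc_real h2 _).preimage (continuous_id.sub continuous_const)
  · show u (z + x₀ - x₀) + (c : EReal) ≠ ⊤
    rw [add_sub_cancel_right, ← coe_rl hb hz, ← EReal.coe_add]
    exact EReal.coe_ne_top _
  · intro M
    obtain ⟨R, hR⟩ := h3 (|M| + 1)
    refine ⟨max (R + ‖x₀‖) ((|M| + 1) * ‖x₀‖ - c), fun x hx => ?_⟩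
    have hx1 := (le_max_left _ _).trans hx
    have hx2 := (le_max_right _ _).trans hx
    have h5 : ‖x‖ - ‖x₀‖ ≤ ‖x - x₀‖ := norm_sub_norm_le _ _
    have h6 := hR (x - x₀) (by linarith)
    have h7 : M * ‖x‖ ≤ (|M| + 1) * ‖x - x₀‖ + c := by
      have := mul_le_mul_of_nonneg_right (le_abs_self M) (norm_nonneg x)
      have := mul_le_mul_of_nonneg_left h5 (by positivity : 0 ≤ |M| + 1)
      linarith
    calc ((M * ‖x‖ : ℝ) : EReal) ≤ (((|M| + 1) * ‖x - x₀‖ + c : ℝ) : EReal) := by exact_mod_cast h7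
      _ = (((|M| + 1) * ‖x - x₀‖ : ℝ) : EReal) + (c : EReal) := EReal.coe_add _ _
      _ ≤ _ := add_le_add h6 le_rfl

theorem epiMul_eq {l : ℝ} (hl : 0 < l) (u : Vn n → EReal) :
    epiMul l u = fun x => (l : EReal) * u (l⁻¹ • x) := by
  simp [epiMul, hl.ne']

theorem epiMul_mem {u : Vn n → EReal} (hu : u ∈ ConvSc n) {l : ℝ} (hl : 0 < l) :
    epiMul l u ∈ ConvSc n := by
  obtain ⟨⟨h1, h2, hb, z, hz⟩, h3⟩ := hu
  have hb' : ∀ x, (l : EReal) * u (l⁻¹ • x) ≠ ⊥ := by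
    intro x
    by_cases hx : u (l⁻¹ • x) = ⊤
    · rw [hx, EReal.coe_mul_top_of_pos hl]; simp
    · rw [← coe_rl hb (x := l⁻¹ • x) hx, ← EReal.coe_mul]; exact EReal.coe_ne_bot _
  rw [epiMul_eq hl]
  refine ⟨⟨of_epi hb' ?_, lsc_of_real hb' ?_, hb', l • z, ?_⟩, ?_⟩
  · intro x y t a b ht0 ht1 ha hb
    have h4 := cvx_epi h1 ht0 ht1 ((mul_coe_le hl).1 ha.le) ((mul_coe_le hl).1 hb.le)
    have e : l⁻¹ • (t • x + (1 - t) • y) = t • (l⁻¹ • x) + (1 - t) • (l⁻¹ • y) := by module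
    rw [mul_coe_le hl, e]
    refine h4.trans (le_of_eq ?_)
    congr 1; ring
  · intro a
    simp only [mul_coe_le hl]
    exact (lsc_real h2 _).preimage (continuous_const_smul _)
  · show (l : EReal) * u (l⁻¹ • (l • z)) ≠ ⊤
    rw [smul_smul, inv_mul_cancel₀ hl.ne', one_smul, ← coe_rl hb hz, ← EReal.coe_mul]
    exact EReal.coe_ne_top _
  · intro M
    obtain ⟨R, hR⟩ := h3 M
    refine ⟨l * R, fun x hx => ?_⟩
    have hn : ‖l⁻¹ • x‖ = l⁻¹ * ‖x‖ := by rw [norm_smul, norm_inv, Real.norm_of_nonneg hl.le]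
    have h6 := hR (l⁻¹ • x) (by rw [hn, ← div_eq_inv_mul, le_div_iff₀ hl]; linarith)
    have e : M * ‖x‖ = l * (M * ‖l⁻¹ • x‖) := by rw [hn]; field_simp
    rw [e, EReal.coe_mul]
    exact mul_le_mul_of_nonneg_left h6 (by exact_mod_cast hl.le)

open Classical in
/-- restriction `u + I_S` -/
def rst (u : Vn n → EReal) (S : Set (Vn n)) : Vn n → EReal := fun x => if x ∈ S then u x else ⊤

theorem rst_in {u : Vn n → EReal} {S : Set (Vn n)} {x : Vn n} (h : x ∈ S) : rst u S x = u x := by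
  simp [rst, h]

theorem rst_out {u : Vn n → EReal} {S : Set (Vn n)} {x : Vn n} (h : x ∉ S) : rst u S x = ⊤ := by
  simp [rst, h]

theorem dm_rst (u : Vn n → EReal) (S : Set (Vn n)) : dm (rst u S) = dm u ∩ S := by
  ext x
  by_cases h : x ∈ S <;> simp [dm, rst, h]

theorem rst_rst (u : Vn n → EReal) (S T : Set (Vn n)) : rst (rst u S) T = rst u (S ∩ T) := by
  funext x
  by_cases h : x ∈ S <;> by_cases h' : x ∈ T <;> simp [rst, h, h']

theorem rst_mem {u : Vn n → EReal} (hu : u ∈ ConvSc n) {S : Set (Vn n)} (hS : IsClosed S)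
    (hc : Convex ℝ S) (hne : (dm u ∩ S).Nonempty) : rst u S ∈ ConvSc n := by
  obtain ⟨⟨h1, h2, hb, -⟩, h3⟩ := hu
  have hle : ∀ x, u x ≤ rst u S x := by
    intro x; by_cases h : x ∈ S
    · rw [rst_in h]
    · rw [rst_out h]; exact le_top
  have hb' : ∀ x, rst u S x ≠ ⊥ := fun x h => hb x (le_bot_iff.1 (h ▸ hle x))
  refine ⟨⟨of_epi hb' ?_, lsc_of_real hb' ?_, hb', ?_⟩, ?_⟩
  · intro x y t a b ht0 ht1 ha hb
    have hx : x ∈ S := by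
      by_contra h; rw [rst_out h] at ha; exact EReal.coe_ne_top _ ha.symm
    have hy : y ∈ S := by
      by_contra h; rw [rst_out h] at hb; exact EReal.coe_ne_top _ hb.symm
    rw [rst_in (hc hx hy ht0.le (by linarith) (by ring))]
    exact cvx_epi h1 ht0 ht1 ((hle x).trans ha.le) ((hle y).trans hb.le)
  · intro a
    have : {x | rst u S x ≤ (a : EReal)} = {x | u x ≤ (a : EReal)} ∩ S := by
      ext x; by_cases h : x ∈ S <;> simp [rst, h]
    rw [this]; exact (lsc_real h2 a).inter hS
  · obtain ⟨x, hx, hxS⟩ := hne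
    exact ⟨x, by rw [rst_in hxS]; exact hx⟩
  · intro M
    obtain ⟨R, hR⟩ := h3 M
    exact ⟨R, fun x hx => (hR x hx).trans (hle x)⟩

theorem epi_convex {uk : ℕ → Vn n → EReal} {u : Vn n → EReal} (h : EpiConverges uk u)
    (hk : ∀ k, IsConvexFn (uk k)) (hb : ∀ x, u x ≠ ⊥) : IsConvexFn u := by
  refine of_epi hb fun x y t a b h0 h1 hx hy => ?_
  have hxd : x ∈ dm u := by rw [dm, Set.mem_ofPred_eq, hx]; exact EReal.coe_ne_top _
  have hyd : y ∈ dm u := by rw [dm, Set.mem_ofPred_eq, hy]; exact EReal.coe_ne_top _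
  obtain ⟨p, c, hp, hc, hpc⟩ := epi_rec h hb hxd
  obtain ⟨q, d, hq, hd, hqd⟩ := epi_rec h hb hyd
  have e1 : rl u x = a := by simp [rl, hx]
  have e2 : rl u y = b := by simp [rl, hy]
  rw [e1] at hc
  rw [e2] at hd
  refine epi_le h ((hp.const_smul t).add (hq.const_smul (1 - t)))
    ((hc.const_mul t).add (hd.const_mul (1 - t))) ?_
  filter_upwards [hpc, hqd] with k h3 h4
  exact cvx_epi (hk k) h0 h1 h3 h4

theorem epi_compact {B : Set (Vn n)} (hB : IsCompact B) (uk : ℕ → Vn n → EReal)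
    (hk : ∀ k, uk k ∈ ConvSc n) (hd : ∀ k, dm (uk k) ⊆ B) (h0 : ∀ k x, 0 ≤ uk k x)
    (h1 : ∀ k, ∃ x, uk k x ≤ 0) :
    ∃ φ : ℕ → ℕ, StrictMono φ ∧ ∃ u ∈ ConvSc n, EpiConverges (fun j => uk (φ j)) u := by
  let b := TopologicalSpace.countableBasis (Vn n)
  have hbb : TopologicalSpace.IsTopologicalBasis b := TopologicalSpace.isBasis_countableBasis _
  have : Countable b := (TopologicalSpace.countable_countableBasis (Vn n)).to_subtype
  obtain ⟨c, φ, hφ, hc⟩ := CompactSpace.tendsto_subseq (X := b → EReal)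
    (fun k U => ⨅ x ∈ U.1, uk k x)
  rw [tendsto_pi_nhds] at hc
  let u : Vn n → EReal := fun x => ⨆ U : b, ⨆ (_ : x ∈ U.1), c U
  have hcu : ∀ (U : b) (x : Vn n), x ∈ U.1 → c U ≤ u x := fun U x hx =>
    le_iSup_of_le U (le_iSup_of_le hx le_rfl)
  have hc0 : ∀ U : b, 0 ≤ c U := fun U =>
    ge_of_tendsto' (hc U) (fun j => le_iInf₂ fun x _ => h0 _ x)
  have hu0 : ∀ x, 0 ≤ u x := by
    intro x
    obtain ⟨U, hU, hxU, -⟩ := hbb.exists_subset_of_mem_open (Set.mem_univ x) isOpen_univ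
    exact (hc0 ⟨U, hU⟩).trans (hcu ⟨U, hU⟩ x hxU)
  have hub : ∀ x, u x ≠ ⊥ := fun x h => by
    have := hu0 x; rw [h] at this; simp at this
  have hlow : ∀ x, ∀ xk : ℕ → Vn n, Tendsto xk atTop (𝓝 x) →
      u x ≤ liminf (fun k => uk (φ k) (xk k)) atTop := by
    intro x xk hx
    refine iSup_le fun U => iSup_le fun hxU => ?_
    rw [← (hc U).liminf_eq]
    refine liminf_le_liminf ?_
    filter_upwards [hx.eventually ((hbb.isOpen U.2).mem_nhds hxU)] with k hkU
    exact iInf₂_le (xk k) hkU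
  have hE : EpiConverges (fun j => uk (φ j)) u := by
    intro x
    refine ⟨hlow x, ?_⟩
    by_cases htop : u x = ⊤
    · refine ⟨fun _ => x, tendsto_const_nhds, ?_⟩
      have h3 := hlow x (fun _ => x) tendsto_const_nhds
      rw [htop] at h3 ⊢
      exact tendsto_of_le_liminf_of_limsup_le h3 le_top
    · set r := rl u x with hr
      have hrx : u x = (r : EReal) := (coe_rl hub htop).symm
      let E : ℕ → Set (Vn n × ℝ) := fun j => {q | uk (φ j) q.1 ≤ (q.2 : EReal)}
      have hEne : ∀ j, (E j).Nonempty := fun j => by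
        obtain ⟨y, hy⟩ := h1 (φ j)
        exact ⟨(y, 0), by simpa [E] using hy⟩
      have hdist : Tendsto (fun j => Metric.infDist (x, r) (E j)) atTop (𝓝 0) := by
        rw [Metric.tendsto_atTop']
        intro ε hε
        obtain ⟨U, hU, hxU, hUs⟩ := hbb.exists_subset_of_mem_open
          (Metric.mem_ball_self (x := x) (half_pos hε)) Metric.isOpen_ball
        have hlt : c ⟨U, hU⟩ < ((r + ε / 2 : ℝ) : EReal) :=
          (hcu ⟨U, hU⟩ x hxU).trans_lt (by rw [hrx]; exact_mod_cast (by linarith : r < r + ε / 2))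
        have hlt2 : ((r - ε / 2 : ℝ) : EReal) < u x := by
          rw [hrx]; exact_mod_cast (by linarith : r - ε / 2 < r)
        obtain ⟨N, hN⟩ := eventually_atTop.1 ((hc ⟨U, hU⟩).eventually_lt_const hlt)
        refine ⟨N, fun j hj => ?_⟩
        have := hN j hj.le
        simp only [Function.comp] at this
        obtain ⟨y, hy⟩ := iInf_lt_iff.1 this
        obtain ⟨hyU, hy⟩ := iInf_lt_iff.1 hy
        rw [Real.dist_0_eq_abs, abs_of_nonneg Metric.infDist_nonneg]
        have hmem : (y, r + ε / 2) ∈ E j := hy.le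
        refine (Metric.infDist_le_dist_of_mem hmem).trans_lt ?_
        rw [Prod.dist_eq, max_lt_iff]
        refine ⟨?_, ?_⟩
        · have := Metric.mem_ball'.1 (hUs hyU)
          simp only
          linarith
        · simp only [Real.dist_eq]
          rw [show r - (r + ε / 2) = -(ε / 2) by ring, abs_neg, abs_of_pos (half_pos hε)]
          linarith
      have hch : ∀ j, ∃ q ∈ E j, dist (x, r) q < Metric.infDist (x, r) (E j) + 1 / ((j : ℝ) + 1) :=
        fun j => (Metric.infDist_lt_iff (hEne j)).1 (by
          have : (0 : ℝ) < 1 / ((j : ℝ) + 1) := by positivity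
          linarith)
      choose q hqE hqd using hch
      have hq : Tendsto q atTop (𝓝 (x, r)) := by
        rw [tendsto_iff_dist_tendsto_zero]
        refine squeeze_zero (fun _ => dist_nonneg) (fun j => (dist_comm _ _).trans_le (hqd j).le) ?_
        simpa using hdist.add tendsto_one_div_add_atTop_nhds_zero_nat
      have hq1 : Tendsto (fun j => (q j).1) atTop (𝓝 x) := (continuous_fst.tendsto _).comp hq
      have hq2 : Tendsto (fun j => (q j).2) atTop (𝓝 r) := (continuous_snd.tendsto _).comp hq
      refine ⟨_, hq1, tendsto_of_le_liminf_of_limsup_le (hlow x _ hq1) ?_⟩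
      have h5 : Tendsto (fun j => ((q j).2 : EReal)) atTop (𝓝 (r : EReal)) := EReal.tendsto_coe.2 hq2
      rw [hrx, ← h5.limsup_eq]
      exact limsup_le_limsup (Eventually.of_forall fun j => hqE j)
  have hout : ∀ x ∉ B, u x = ⊤ := by
    intro x hx
    obtain ⟨U, hU, hxU, hUs⟩ := hbb.exists_subset_of_mem_open (a := x) (u := Bᶜ) hx
      hB.isClosed.isOpen_compl
    refine top_le_iff.1 (le_trans ?_ (hcu ⟨U, hU⟩ x hxU))
    refine ge_of_tendsto' (hc ⟨U, hU⟩) (fun j => le_iInf₂ fun y hy => ?_)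
    rw [top_le_iff]
    by_contra hne
    exact hUs hy (hd _ hne)
  refine ⟨φ, hφ, u, ⟨⟨epi_convex hE (fun j => (hk _).1.1) hub, ?_, hub, ?_⟩, ?_⟩, hE⟩
  · rw [lowerSemicontinuous_iff_isOpen_preimage]
    intro a
    rw [isOpen_iff_mem_nhds]
    intro x hx
    obtain ⟨U, hU⟩ := lt_iSup_iff.1 (show a < u x from hx)
    obtain ⟨hxU, hU⟩ := lt_iSup_iff.1 hU
    filter_upwards [(hbb.isOpen U.2).mem_nhds hxU] with y hy
    exact hU.trans_le (hcu U y hy)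
  · choose x hx using h1
    have hxB : ∀ k, x k ∈ B := fun k => hd k (by
      have := (hx k).trans_lt EReal.zero_lt_top
      exact this.ne)
    obtain ⟨x0, -, ψ, hψ, hψx⟩ := hB.tendsto_subseq (fun j => hxB (φ j))
    have := epi_le (epi_subseq hE hψ) hψx (tendsto_const_nhds (x := (0:ℝ)))
      (Eventually.of_forall fun j => by simpa using hx (φ (ψ j)))
    exact ⟨x0, (this.trans_lt (EReal.coe_lt_top _)).ne⟩
  · intro M
    obtain ⟨R, hR⟩ := hB.isBounded.exists_norm_le
    refine ⟨R + 1, fun x hx => ?_⟩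
    rw [hout x (fun h => by linarith [hR x h])]
    exact le_top

end Cl


namespace Cl
variable {n : ℕ}

structure Hyp (Z : (Vn n → EReal) → ℝ) : Prop where
  c : ContinuousVal (ConvSc n) Z
  v : IsValuation (ConvSc n) Z
  t : EpiTranslationInvariant (ConvSc n) Z
  h : EpiHomogeneous (ConvSc n) Z (n : ℝ)

/-- either a super-coercive function or identically `+∞` -/
def W (u : Vn n → EReal) : Prop := u ∈ ConvSc n ∨ ∀ x, u x = ⊤

open Classical in
def Zx (Z : (Vn n → EReal) → ℝ) (u : Vn n → EReal) : ℝ := if u ∈ ConvSc n then Z u else 0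

theorem Zx_mem {Z : (Vn n → EReal) → ℝ} {u : Vn n → EReal} (h : u ∈ ConvSc n) : Zx Z u = Z u := by
  simp [Zx, h]

theorem Zx_top {Z : (Vn n → EReal) → ℝ} {u : Vn n → EReal} (h : ∀ x, u x = ⊤) : Zx Z u = 0 := by
  have : u ∉ ConvSc n := by
    rintro ⟨⟨-, -, -, x, hx⟩, -⟩
    exact hx (h x)
  simp [Zx, this]

theorem Zx_empty {Z : (Vn n → EReal) → ℝ} {u : Vn n → EReal} (h : dm u = ∅) : Zx Z u = 0 := by
  refine Zx_top fun x => ?_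
  by_contra hx
  have : x ∈ dm u := hx
  rw [h] at this
  exact this

theorem W.mem {u : Vn n → EReal} (h : W u) (hne : (dm u).Nonempty) : u ∈ ConvSc n := by
  rcases h with h | h
  · exact h
  · obtain ⟨x, hx⟩ := hne
    exact absurd (h x) hx

theorem W.bot {u : Vn n → EReal} (h : W u) : ∀ x, u x ≠ ⊥ := by
  rcases h with h | h
  · exact h.1.2.2.1
  · intro x; rw [h x]; simp

theorem W.rst {u : Vn n → EReal} (h : W u) {S : Set (Vn n)} (hS : IsClosed S)
    (hc : Convex ℝ S) : W (rst u S) := by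
  by_cases hne : (dm u ∩ S).Nonempty
  · exact Or.inl (rst_mem (h.mem hne.left) hS hc hne)
  · right
    intro x
    by_contra hx
    have : x ∈ dm (Cl.rst u S) := hx
    rw [dm_rst] at this
    exact hne ⟨x, this⟩

theorem W.transl {u : Vn n → EReal} (h : W u) (x₀ : Vn n) (c : ℝ) :
    W (fun x => u (x - x₀) + (c : EReal)) := by
  rcases h with h | h
  · exact Or.inl (transl_mem h x₀ c)
  · right; intro x; simp [h]

theorem W.epiMul {u : Vn n → EReal} (h : W u) {l : ℝ} (hl : 0 < l) : W (epiMul l u) := by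
  rcases h with h | h
  · exact Or.inl (epiMul_mem h hl)
  · right; intro x; rw [epiMul_eq hl]; simp [h, EReal.coe_mul_top_of_pos hl]

theorem Zx_transl {Z : (Vn n → EReal) → ℝ} (H : Hyp Z) {u : Vn n → EReal} (h : W u) (x₀ : Vn n) (c : ℝ) :
    Zx Z (fun x => u (x - x₀) + (c : EReal)) = Zx Z u := by
  rcases h with h | h
  · rw [Zx_mem h, Zx_mem (transl_mem h x₀ c), H.t u h]
  · rw [Zx_top h, Zx_top]; intro x; simp [h]

theorem Zx_epiMul {Z : (Vn n → EReal) → ℝ} (H : Hyp Z) {u : Vn n → EReal} (h : W u) {l : ℝ} (hl : 0 < l) :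
    Zx Z (epiMul l u) = l ^ n * Zx Z u := by
  rcases h with h | h
  · rw [Zx_mem h, Zx_mem (epiMul_mem h hl), H.h u h l hl, Real.rpow_natCast]
  · rw [Zx_top h, Zx_top]
    · simp
    · intro x; rw [epiMul_eq hl]; simp [h, EReal.coe_mul_top_of_pos hl]

theorem dm_transl (u : Vn n → EReal) (hb : ∀ x, u x ≠ ⊥) (x₀ : Vn n) (c : ℝ) (x : Vn n) :
    x ∈ dm (fun x => u (x - x₀) + (c : EReal)) ↔ x - x₀ ∈ dm u := by
  show u (x - x₀) + (c : EReal) ≠ ⊤ ↔ u (x - x₀) ≠ ⊤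
  by_cases h : u (x - x₀) = ⊤
  · simp [h]
  · rw [← coe_rl hb (x := x - x₀) h, ← EReal.coe_add]
    simp only [ne_eq, EReal.coe_ne_top]

def box (a s : Fin n → ℝ) : Set (Vn n) := {x | ∀ i, a i ≤ x i ∧ x i ≤ a i + s i}

theorem mem_box {a s : Fin n → ℝ} {x : Vn n} : x ∈ box a s ↔ ∀ i, a i ≤ x i ∧ x i ≤ a i + s i := Iff.rfl

theorem coord_cont (i : Fin n) : Continuous fun x : Vn n => x i := by fun_prop

theorem closed_le (i : Fin n) (c : ℝ) : IsClosed {x : Vn n | x i ≤ c} :=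
  isClosed_le (coord_cont i) continuous_const
theorem closed_ge (i : Fin n) (c : ℝ) : IsClosed {x : Vn n | c ≤ x i} :=
  isClosed_le continuous_const (coord_cont i)
theorem convex_le (i : Fin n) (c : ℝ) : Convex ℝ {x : Vn n | x i ≤ c} := by
  intro x hx y hy a b ha hb hab
  simp only [Set.mem_ofPred_eq, PiLp.add_apply, PiLp.smul_apply, smul_eq_mul] at *
  calc a * x i + b * y i ≤ a * c + b * c := by gcongr
    _ = c := by rw [← add_mul, hab, one_mul]
theorem convex_ge (i : Fin n) (c : ℝ) : Convex ℝ {x : Vn n | c ≤ x i} := by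
  intro x hx y hy a b ha hb hab
  simp only [Set.mem_ofPred_eq, PiLp.add_apply, PiLp.smul_apply, smul_eq_mul] at *
  calc c = a * c + b * c := by rw [← add_mul, hab, one_mul]
    _ ≤ a * x i + b * y i := by gcongr

theorem box_eq (a s : Fin n → ℝ) : box a s = ⋂ i, ({x : Vn n | a i ≤ x i} ∩ {x : Vn n | x i ≤ a i + s i}) := by
  ext x; simp [mem_box]

theorem box_closed (a s : Fin n → ℝ) : IsClosed (box a s) := by
  rw [box_eq]; exact isClosed_iInter fun i => (closed_ge i _).inter (closed_le i _)

theorem box_convex (a s : Fin n → ℝ) : Convex ℝ (box a s) := by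
  rw [box_eq]; exact convex_iInter fun i => (convex_ge i _).inter (convex_le i _)

theorem box_compact (a s : Fin n → ℝ) : IsCompact (box a s) := by
  have h : IsCompact (Set.pi Set.univ fun i => Set.Icc (a i) (a i + s i)) :=
    isCompact_univ_pi fun i => isCompact_Icc
  have := h.image (PiLp.continuous_toLp 2 (fun _ : Fin n => ℝ))
  refine this.of_isClosed_subset (box_closed a s) ?_
  intro x hx
  exact ⟨WithLp.ofLp x, fun i _ => hx i, rfl⟩

theorem bound0 {Z : (Vn n → EReal) → ℝ} (H : Hyp Z) : ∃ C : ℝ, ∀ u ∈ ConvSc n,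
    dm u ⊆ box 0 1 → (∀ x, 0 ≤ u x) → (∃ x, u x ≤ 0) → |Z u| ≤ C := by
  by_contra hcon
  push Not at hcon
  choose uk h1 h2 h3 h4 h5 using fun k : ℕ => hcon k
  obtain ⟨φ, hφ, u, hu, hE⟩ := epi_compact (box_compact 0 1) uk h1 h2 h3 h4
  have h6 := (H.c _ _ (fun j => h1 (φ j)) hu hE).abs
  have h7 : Tendsto (fun j => |Z (uk (φ j))|) atTop atTop :=
    tendsto_atTop_mono (fun j => (h5 (φ j)).le)
      (tendsto_natCast_atTop_atTop.comp hφ.tendsto_atTop)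
  exact not_tendsto_nhds_of_tendsto_atTop h7 _ h6

theorem bound {Z : (Vn n → EReal) → ℝ} (H : Hyp Z) : ∃ C : ℝ, 0 ≤ C ∧ ∀ u, W u → ∀ a : Fin n → ℝ,
    dm u ⊆ box a 1 → |Zx Z u| ≤ C := by
  obtain ⟨C, hC⟩ := bound0 H
  refine ⟨max C 0, le_max_right _ _, fun u hu a hd => ?_⟩
  by_cases hne : (dm u).Nonempty
  swap
  · rw [Zx_empty (Set.not_nonempty_iff_eq_empty.1 hne)]; simp
  have hb := hu.bot
  have hum := hu.mem hne
  obtain ⟨x0, hx0, hmin⟩ := (hum.1.2.1.lowerSemicontinuousOn (box a 1)).exists_isMinOn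
    (hne.mono hd) (box_compact a 1)
  have hmin' : ∀ x, u x0 ≤ u x := by
    intro x
    by_cases hx : x ∈ dm u
    · exact hmin (hd hx)
    · have : u x = ⊤ := by simpa [dm] using hx
      rw [this]; exact le_top
  have hx0d : x0 ∈ dm u := by
    obtain ⟨y, hy⟩ := hne
    exact fun h => hy (top_le_iff.1 (h ▸ hmin' y))
  have hr := coe_rl hb hx0d
  rw [← Zx_transl H hu (-(WithLp.toLp 2 a)) (-(rl u x0))]
  rw [Zx_mem (transl_mem hum _ _)]
  refine (hC _ (transl_mem hum _ _) ?_ ?_ ?_).trans (le_max_left _ _)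
  · intro x hx
    rw [dm_transl u hb] at hx
    have := hd hx
    intro i
    have := this i
    simp at this ⊢
    constructor <;> linarith
  · intro x
    have h1 := hmin' (x - -WithLp.toLp 2 a)
    calc (0 : EReal) = ((rl u x0 + -rl u x0 : ℝ) : EReal) := by simp
      _ = (rl u x0 : EReal) + ((-rl u x0 : ℝ) : EReal) := EReal.coe_add _ _
      _ ≤ _ := add_le_add (hr ▸ h1) le_rfl
  · refine ⟨x0 + -WithLp.toLp 2 a, ?_⟩
    simp only [add_sub_cancel_right]
    rw [← hr, ← EReal.coe_add]
    simp

theorem cut {Z : (Vn n → EReal) → ℝ} (H : Hyp Z) {u : Vn n → EReal} (hu : W u) (i : Fin n) (c : ℝ) :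
    Zx Z u = Zx Z (rst u {x | x i ≤ c}) + Zx Z (rst u {x | c ≤ x i}) - Zx Z (rst u {x | x i = c}) := by
  have hb := hu.bot
  have hsub : ∀ S T : Set (Vn n), T ⊆ S → dm u ∩ S = ∅ → Zx Z (rst u T) = 0 := fun S T hT h => by
    apply Zx_empty; rw [dm_rst]
    exact Set.subset_empty_iff.1 (h ▸ Set.inter_subset_inter_right _ hT)
  have hfull : ∀ S : Set (Vn n), dm u ⊆ S → rst u S = u := by
    intro S hS
    funext x
    by_cases hx : x ∈ S
    · exact rst_in hx
    · rw [rst_out hx]; by_contra h; exact hx (hS (fun h' => h h'.symm))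
  by_cases hA : (dm u ∩ {x | x i ≤ c}).Nonempty
  swap
  · rw [Set.not_nonempty_iff_eq_empty] at hA
    rw [hsub _ _ le_rfl hA, hsub _ {x | x i = c} (fun x hx => le_of_eq hx) hA, hfull {x | c ≤ x i}]
    · ring
    · intro x hx
      by_contra h
      have h : ¬ c ≤ x i := h
      have : x ∈ dm u ∩ {x | x i ≤ c} := ⟨hx, (not_le.1 h).le⟩
      rw [hA] at this; exact this
  by_cases hB : (dm u ∩ {x | c ≤ x i}).Nonempty
  swap
  · rw [Set.not_nonempty_iff_eq_empty] at hB
    rw [hsub {x | c ≤ x i} _ le_rfl hB, hsub _ {x | x i = c} (fun x hx => le_of_eq hx.symm) hB,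
      hfull {x | x i ≤ c}]
    · ring
    · intro x hx
      by_contra h
      have h : ¬ x i ≤ c := h
      have : x ∈ dm u ∩ {x | c ≤ x i} := ⟨hx, (not_le.1 h).le⟩
      rw [hB] at this; exact this
  have hum := hu.mem hA.left
  have h1 := rst_mem hum (closed_le i c) (convex_le i c) hA
  have h2 := rst_mem hum (closed_ge i c) (convex_ge i c) hB
  have hce : {x : Vn n | x i = c} = {x | x i ≤ c} ∩ {x | c ≤ x i} := by
    ext x; simp [le_antisymm_iff]
  have hC : (dm u ∩ {x | x i = c}).Nonempty := by
    obtain ⟨x, hx, hxc⟩ := hA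
    obtain ⟨y, hy, hyc⟩ := hB
    have hcv : Convex ℝ (dm u) := convex_dm hum.1.1 hb
    have hpre := (hcv.isPreconnected.image (fun x : Vn n => x i) (coord_cont i).continuousOn)
    have := hpre.ordConnected.out ⟨x, hx, rfl⟩ ⟨y, hy, rfl⟩ ⟨hxc, hyc⟩
    obtain ⟨z, hz, hzc⟩ := this
    exact ⟨z, hz, hzc⟩
  have h3 : rst u {x | x i = c} ∈ ConvSc n := by
    refine rst_mem hum ?_ ?_ hC
    · rw [hce]; exact (closed_le i c).inter (closed_ge i c)
    · rw [hce]; exact (convex_le i c).inter (convex_ge i c)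
  have es : rst u {x | x i ≤ c} ⊔ rst u {x | c ≤ x i} = rst u {x | x i = c} := by
    funext x
    simp only [Pi.sup_apply]
    rcases lt_trichotomy (x i) c with h | h | h
    · rw [rst_out (S := {x | c ≤ x i}) (not_le.2 h), rst_out (S := {x | x i = c}) h.ne]; simp
    · rw [rst_in (S := {x | c ≤ x i}) h.ge, rst_in (S := {x | x i = c}) h,
        rst_in (S := {x | x i ≤ c}) h.le]; simp
    · rw [rst_out (S := {x | x i ≤ c}) (not_le.2 h), rst_out (S := {x | x i = c}) h.ne']; simp
  have ei : rst u {x | x i ≤ c} ⊓ rst u {x | c ≤ x i} = u := by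
    funext x
    simp only [Pi.inf_apply]
    rcases lt_trichotomy (x i) c with h | h | h
    · rw [rst_out (S := {x | c ≤ x i}) (not_le.2 h), rst_in (S := {x | x i ≤ c}) h.le]; simp
    · rw [rst_in (S := {x | c ≤ x i}) h.ge, rst_in (S := {x | x i ≤ c}) h.le]; simp
    · rw [rst_out (S := {x | x i ≤ c}) (not_le.2 h), rst_in (S := {x | c ≤ x i}) h.le]; simp
  have := H.v _ _ h1 h2 (es ▸ h3) (ei.symm ▸ hum)
  rw [es, ei] at this
  rw [Zx_mem hum, Zx_mem h1, Zx_mem h2, Zx_mem h3]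
  linarith

def Flat (J : Finset (Fin n)) (u : Vn n → EReal) : Prop := ∀ i ∈ J, ∃ c, ∀ x ∈ dm u, x i = c

theorem Flat.mono {J : Finset (Fin n)} {u v : Vn n → EReal} (h : Flat J u) (hs : dm v ⊆ dm u) : Flat J v :=
  fun i hi => by
    obtain ⟨c, hc⟩ := h i hi
    exact ⟨c, fun x hx => hc x (hs hx)⟩

theorem mem_dm_epiMul {u : Vn n → EReal} (hb : ∀ x, u x ≠ ⊥) {l : ℝ} (hl : 0 < l) {x : Vn n} :
    x ∈ dm (epiMul l u) ↔ l⁻¹ • x ∈ dm u := by rw [dm_epiMul hb hl]; rfl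

theorem Flat.epiMul {J : Finset (Fin n)} {u : Vn n → EReal} (h : Flat J u) (hb : ∀ x, u x ≠ ⊥)
    {l : ℝ} (hl : 0 < l) : Flat J (epiMul l u) := fun i hi => by
  obtain ⟨c, hc⟩ := h i hi
  refine ⟨l * c, fun x hx => ?_⟩
  have := hc _ ((mem_dm_epiMul hb hl).1 hx)
  rw [← this]; simp [hl.ne']

theorem halving {Z : (Vn n → EReal) → ℝ} (H : Hyp Z) {J : Finset (Fin n)} {B : ℝ}
    (hB : ∀ u, W u → Flat J u → ∀ a : Fin n → ℝ, dm u ⊆ box a 1 → |Zx Z u| ≤ B)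
    (hI : ∀ i ∉ J, ∀ u, W u → Flat (insert i J) u → ∀ a : Fin n → ℝ, dm u ⊆ box a 1 → Zx Z u = 0)
    (T : Finset (Fin n)) (hT : Disjoint T J) :
    ∀ u, W u → Flat J u → ∀ a : Fin n → ℝ, dm u ⊆ box a (fun i => if i ∈ T then 1 else 1 / 2) →
      2 ^ n * |Zx Z u| ≤ 2 ^ T.card * B := by
  induction T using Finset.induction_on with
  | empty =>
    intro u hu hf a hd
    have := hB _ (hu.epiMul two_pos) (hf.epiMul hu.bot two_pos) (fun i => 2 * a i) (fun x hx i => by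
      have := hd ((mem_dm_epiMul hu.bot two_pos).1 hx) i
      simp at this ⊢
      constructor <;> linarith)
    rw [Zx_epiMul H hu two_pos, abs_mul, abs_of_pos (by positivity)] at this
    simpa using this
  | insert i T hi ih =>
    intro u hu hf a hd
    rw [Finset.disjoint_insert_left] at hT
    have ih := ih hT.2
    rw [Finset.card_insert_of_notMem hi, cut H hu i (a i + 1 / 2)]
    have hd1 : dm u ⊆ box a 1 := fun x hx j => by
      have := hd hx j
      simp only [Pi.one_apply]
      simp only [] at this
      split_ifs at this <;> constructor <;> linarith
    have w3 : W (rst u {x | x i = a i + 1 / 2}) := by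
      have hce : {x : Vn n | x i = a i + 1/2} = {x | x i ≤ a i + 1/2} ∩ {x | a i + 1/2 ≤ x i} := by
        ext x; simp [le_antisymm_iff]
      rw [hce]
      exact hu.rst ((closed_le i _).inter (closed_ge i _)) ((convex_le i _).inter (convex_ge i _))
    have sub : ∀ S, dm (rst u S) ⊆ dm u := fun S => by rw [dm_rst]; exact Set.inter_subset_left
    have z3 : Zx Z (rst u {x | x i = a i + 1 / 2}) = 0 := by
      refine hI i hT.1 _ w3 ?_ a ((sub _).trans hd1)
      intro j hj
      rcases Finset.mem_insert.1 hj with rfl | hj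
      · exact ⟨_, fun x hx => by rw [dm_rst] at hx; exact hx.2⟩
      · exact hf.mono (sub _) j hj
    rw [z3, sub_zero]
    have i1 := ih _ (hu.rst (closed_le i (a i + 1 / 2)) (convex_le i _)) (hf.mono (sub _)) a
      (fun x hx j => by
        rw [dm_rst] at hx
        have h1 := hd hx.1 j
        have h2 : x i ≤ a i + 1 / 2 := hx.2
        by_cases hj : j = i
        · subst hj
          simp only [hi, if_false]
          exact ⟨h1.1, h2⟩
        · simpa [hj] using h1)
    have i2 := ih _ (hu.rst (closed_ge i (a i + 1 / 2)) (convex_ge i _)) (hf.mono (sub _))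
      (Function.update a i (a i + 1 / 2))
      (fun x hx j => by
        rw [dm_rst] at hx
        have h1 := hd hx.1 j
        have h2 : a i + 1 / 2 ≤ x i := hx.2
        by_cases hj : j = i
        · subst hj
          simp only [Finset.mem_insert_self, if_true] at h1
          simp only [hi, if_false, Function.update_self]
          exact ⟨h2, by linarith⟩
        · simpa [hj] using h1)
    rw [pow_succ]
    have := mul_le_mul_of_nonneg_left (abs_add_le (Zx Z (rst u {x | x i ≤ a i + 1 / 2}))
      (Zx Z (rst u {x | a i + 1 / 2 ≤ x i}))) (by positivity : (0:ℝ) ≤ 2 ^ n)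
    linarith

theorem vanish_unit {Z : (Vn n → EReal) → ℝ} (H : Hyp Z) (m : ℕ) : ∀ J : Finset (Fin n), J.Nonempty →
    Jᶜ.card = m → ∀ u, W u → Flat J u → ∀ a : Fin n → ℝ, dm u ⊆ box a 1 → Zx Z u = 0 := by
  induction m using Nat.strong_induction_on with
  | _ m IH =>
  intro J hJ hm
  obtain ⟨C, hC0, hC⟩ := bound H
  have hI : ∀ i ∉ J, ∀ u, W u → Flat (insert i J) u → ∀ a : Fin n → ℝ, dm u ⊆ box a 1 → Zx Z u = 0 := by
    intro i hi
    refine IH _ ?_ (insert i J) (Finset.insert_nonempty _ _) rfl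
    rw [← hm]
    apply Finset.card_lt_card
    rw [Finset.compl_ssubset_compl]
    exact Finset.ssubset_insert hi
  have key : ∀ k : ℕ, ∀ u, W u → Flat J u → ∀ a : Fin n → ℝ, dm u ⊆ box a 1 → |Zx Z u| ≤ C * (1 / 2) ^ k := by
    intro k
    induction k with
    | zero => intro u hu _ a ha; simpa using hC u hu a ha
    | succ k ih =>
      intro u hu hf a ha
      have hcc : Jᶜ.card + 1 ≤ n := by
        have := Finset.card_compl_add_card J
        rw [Fintype.card_fin] at this
        have := hJ.card_pos
        omega
      by_cases hne : (dm u).Nonempty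
      swap
      · rw [Zx_empty (Set.not_nonempty_iff_eq_empty.1 hne)]; simp; positivity
      obtain ⟨y, hy⟩ := hne
      have := halving H ih hI Jᶜ disjoint_compl_left u hu hf (fun i => if i ∈ J then y i else a i)
        (fun x hx i => by
          by_cases hi : i ∈ J
          · obtain ⟨c, hc⟩ := hf i hi
            simp [hi, hc x hx, hc y hy]
          · simpa [hi] using ha hx i)
      obtain ⟨d, hd⟩ := Nat.exists_eq_add_of_le hcc
      have h2 : (2:ℝ) ^ n = 2 ^ Jᶜ.card * 2 * 2 ^ d := by
        conv_lhs => rw [hd]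
        rw [pow_add, pow_succ]
      have h3 : (1:ℝ) ≤ 2 ^ d := one_le_pow₀ (by norm_num)
      have h4 : (0:ℝ) < 2 ^ Jᶜ.card := by positivity
      rw [h2, mul_assoc, mul_assoc] at this
      have h5 := le_of_mul_le_mul_left this h4
      have h6 : |Zx Z u| ≤ 2 ^ d * |Zx Z u| := le_mul_of_one_le_left (abs_nonneg _) h3
      rw [pow_succ]; linarith
  intro u hu hf a ha
  have h1 : Tendsto (fun k : ℕ => C * (1 / 2 : ℝ) ^ k) atTop (𝓝 (C * 0)) :=
    (tendsto_pow_atTop_nhds_zero_of_lt_one (by norm_num) (by norm_num)).const_mul C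
  rw [mul_zero] at h1
  have := ge_of_tendsto' h1 (fun k => key k u hu hf a ha)
  exact abs_nonpos_iff.1 this

def Bdd (u : Vn n → EReal) : Prop := ∃ R : ℝ, ∀ x ∈ dm u, ∀ i, |x i| ≤ R

theorem Bdd.mono {u v : Vn n → EReal} (h : Bdd u) (hs : dm v ⊆ dm u) : Bdd v := by
  obtain ⟨R, hR⟩ := h
  exact ⟨R, fun x hx => hR x (hs hx)⟩

theorem vanish {Z : (Vn n → EReal) → ℝ} (H : Hyp Z) {u : Vn n → EReal} (hu : W u) (hb : Bdd u) (i : Fin n)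
    (c : ℝ) (hc : ∀ x ∈ dm u, x i = c) : Zx Z u = 0 := by
  obtain ⟨R, hR⟩ := hb
  set L := max R 1 with hL
  have hL0 : 0 < L := lt_of_lt_of_le one_pos (le_max_right _ _)
  have hl : 0 < (2 * L)⁻¹ := by positivity
  have hf : Flat {i} u := fun j hj => by
    rw [Finset.mem_singleton] at hj; subst hj; exact ⟨c, hc⟩
  have := vanish_unit H _ {i} (Finset.singleton_nonempty i) rfl _ (hu.epiMul hl)
    (hf.epiMul hu.bot hl) (fun _ => - (1/2)) (fun x hx j => by
      have h1 := hR _ ((mem_dm_epiMul hu.bot hl).1 hx) j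
      have h2 : |(2 * L) * x j| ≤ L := by
        have : ((2 * L)⁻¹⁻¹ • x) j = (2 * L) * x j := by simp
        rw [this] at h1
        exact h1.trans (le_max_left _ _)
      rw [abs_mul, abs_of_pos (by positivity)] at h2
      have h3 : |x j| ≤ 1 / 2 := by
        by_contra h
        push Not at h
        nlinarith
      have := abs_le.1 h3
      simp only [Pi.one_apply]
      constructor <;> linarith)
  rw [Zx_epiMul H hu hl] at this
  exact (mul_eq_zero.1 this).resolve_left (by positivity)

theorem cut' {Z : (Vn n → EReal) → ℝ} (H : Hyp Z) {u : Vn n → EReal} (hu : W u) (hb : Bdd u) (i : Fin n)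
    (c : ℝ) : Zx Z u = Zx Z (rst u {x | x i ≤ c}) + Zx Z (rst u {x | c ≤ x i}) := by
  have w3 : W (rst u {x | x i = c}) := by
    have hce : {x : Vn n | x i = c} = {x | x i ≤ c} ∩ {x | c ≤ x i} := by
      ext x; simp [le_antisymm_iff]
    rw [hce]
    exact hu.rst ((closed_le i _).inter (closed_ge i _)) ((convex_le i _).inter (convex_ge i _))
  rw [cut H hu i c, vanish H w3 (hb.mono (by rw [dm_rst]; exact Set.inter_subset_left)) i c
    (fun x hx => by rw [dm_rst] at hx; exact hx.2), sub_zero]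

end Cl


namespace Cl
variable {n : ℕ}

def slab (i : Fin n) (k : ℤ) : Set (Vn n) := {x | (k : ℝ) ≤ x i} ∩ {x | x i ≤ k + 1}

theorem slab_closed (i : Fin n) (k : ℤ) : IsClosed (slab i k) := (closed_ge i _).inter (closed_le i _)
theorem slab_convex (i : Fin n) (k : ℤ) : Convex ℝ (slab i k) := (convex_ge i _).inter (convex_le i _)

theorem dm_rst_sub (u : Vn n → EReal) (S : Set (Vn n)) : dm (rst u S) ⊆ dm u := by
  rw [dm_rst]; exact Set.inter_subset_left

theorem rst_congr {u : Vn n → EReal} {S T : Set (Vn n)} (h : dm u ∩ S = dm u ∩ T) : rst u S = rst u T := by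
  funext x
  by_cases hx : x ∈ dm u
  · have : x ∈ S ↔ x ∈ T := by
      have := Set.ext_iff.1 h x
      simpa [hx] using this
    by_cases hS : x ∈ S
    · rw [rst_in hS, rst_in (this.1 hS)]
    · rw [rst_out hS, rst_out (fun h => hS (this.2 h))]
  · have : u x = ⊤ := by simpa [dm] using hx
    simp [rst, this]

theorem slab_sum {Z : (Vn n → EReal) → ℝ} (H : Hyp Z) (i : Fin n) (a : ℤ) (m : ℕ) :
    ∀ u : Vn n → EReal, W u → Bdd u → (∀ x ∈ dm u, (a : ℝ) ≤ x i ∧ x i ≤ a + m) →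
    Zx Z u = ∑ k ∈ Finset.Ico a (a + m), Zx Z (rst u (slab i k)) := by
  induction m with
  | zero =>
    intro u hu hb hd
    rw [vanish H hu hb i a (fun x hx => le_antisymm (by simpa using (hd x hx).2) (hd x hx).1)]
    simp
  | succ m ih =>
    intro u hu hb hd
    have e : Finset.Ico a (a + ((m + 1 : ℕ) : ℤ)) = insert (a + m) (Finset.Ico a (a + m)) := by
      ext k; simp; omega
    rw [e, Finset.sum_insert (by simp), cut' H hu hb i (a + m : ℝ), add_comm]
    congr 1
    · congr 1
      refine rst_congr ?_
      ext x
      simp only [slab, Set.mem_inter_iff, Set.mem_ofPred_eq]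
      push_cast
      constructor
      · rintro ⟨h1, h2⟩
        refine ⟨h1, h2, ?_⟩
        have := (hd x h1).2
        push_cast at this
        linarith
      · rintro ⟨h1, h2, _⟩
        exact ⟨h1, h2⟩
    · rw [ih _ (hu.rst (closed_le i _) (convex_le i _)) (hb.mono (dm_rst_sub _ _))]
      · refine Finset.sum_congr rfl fun k hk => ?_
        rw [rst_rst]
        congr 2
        rw [Set.inter_eq_right]
        intro x hx
        have h1 : x i ≤ k + 1 := hx.2
        have h2 : ((k + 1 : ℤ) : ℝ) ≤ ((a + m : ℤ) : ℝ) := by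
          have := (Finset.mem_Ico.1 hk).2
          exact_mod_cast (by omega : k + 1 ≤ a + m)
        push_cast at h2
        exact h1.trans h2
      · intro x hx
        rw [dm_rst] at hx
        exact ⟨(hd x hx.1).1, hx.2⟩

def cell (T : Finset (Fin n)) (z : Fin n → ℤ) : Set (Vn n) := ⋂ i ∈ T, slab i (z i)

theorem cell_closed (T : Finset (Fin n)) (z : Fin n → ℤ) : IsClosed (cell T z) :=
  isClosed_biInter fun i _ => slab_closed i _
theorem cell_convex (T : Finset (Fin n)) (z : Fin n → ℤ) : Convex ℝ (cell T z) :=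
  convex_iInter₂ fun i _ => slab_convex i _

theorem box_sum {Z : (Vn n → EReal) → ℝ} (H : Hyp Z) {a : ℤ} {m : ℕ} {u : Vn n → EReal} (hu : W u)
    (hb : Bdd u) (hd : ∀ x ∈ dm u, ∀ i, (a : ℝ) ≤ x i ∧ x i ≤ a + m) (T : Finset (Fin n)) :
    Zx Z u = ∑ z ∈ Fintype.piFinset (fun i => if i ∈ T then Finset.Ico a (a + m) else {0}),
      Zx Z (rst u (cell T z)) := by
  induction T using Finset.induction_on with
  | empty =>
    have e : (Fintype.piFinset (fun i : Fin n => if i ∈ (∅ : Finset (Fin n)) then Finset.Ico a (a + m) else {0}))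
      = {0} := by
      ext z; simp [funext_iff]
    rw [e, Finset.sum_singleton]
    congr 1
    funext x
    rw [rst_in]
    simp [cell]
  | insert i T hi ih =>
    rw [ih]
    have step : ∀ z : Fin n → ℤ, Zx Z (rst u (cell T z)) =
        ∑ k ∈ Finset.Ico a (a + m), Zx Z (rst u (cell (insert i T) (Function.update z i k))) := by
      intro z
      rw [slab_sum H i a m _ (hu.rst (cell_closed T z) (cell_convex T z)) (hb.mono (dm_rst_sub _ _))
        (fun x hx => hd x (dm_rst_sub _ _ hx) i)]
      refine Finset.sum_congr rfl fun k _ => ?_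
      rw [rst_rst]
      congr 2
      ext x
      simp only [cell, Set.mem_inter_iff, Set.mem_iInter, Finset.mem_insert, forall_eq_or_imp,
        Function.update_self]
      rw [and_comm]
      refine and_congr Iff.rfl (forall₂_congr fun j hj => ?_)
      have hji : j ≠ i := fun h => hi (h ▸ hj)
      rw [Function.update_of_ne hji]
    rw [Finset.sum_congr rfl fun z _ => step z, ← Finset.sum_product']
    refine Finset.sum_nbij' (fun q => Function.update q.1 i q.2)
      (fun z => (Function.update z i 0, z i)) ?_ ?_ ?_ ?_ ?_
    · rintro ⟨z, k⟩ hq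
      simp only [Finset.mem_product, Fintype.mem_piFinset] at hq ⊢
      intro j
      by_cases hj : j = i
      · subst hj; simpa using hq.2
      · simpa [hj] using hq.1 j
    · intro z hz
      simp only [Finset.mem_product, Fintype.mem_piFinset] at hz ⊢
      refine ⟨fun j => ?_, by simpa using hz i⟩
      by_cases hj : j = i
      · subst hj; simp [hi]
      · simpa [hj] using hz j
    · rintro ⟨z, k⟩ hq
      simp only [Finset.mem_product, Fintype.mem_piFinset] at hq
      have h1 : z i = 0 := by simpa [hi] using hq.1 i
      simp [← h1]
    · intro z hz
      simp
    · rintro ⟨z, k⟩ hq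
      rfl

theorem cell_univ (z : Fin n → ℤ) : cell Finset.univ z = box (fun i => (z i : ℝ)) 1 := by
  ext x; simp [cell, slab, mem_box]

def flo (x : Vn n) : Fin n → ℤ := fun i => ⌊x i⌋

theorem flo_pre (z : Fin n → ℤ) : flo ⁻¹' {z} = (MeasurableEquiv.toLp 2 (Fin n → ℝ)).symm ⁻¹'
    (Set.pi Set.univ fun i => Set.Ico (z i : ℝ) (z i + 1)) := by
  ext x
  simp [flo, funext_iff, Int.floor_eq_iff]

theorem flo_meas (z : Fin n → ℤ) : MeasurableSet (flo ⁻¹' {z} : Set (Vn n)) := by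
  rw [flo_pre]
  exact (MeasurableEquiv.measurable _) (MeasurableSet.univ_pi fun i => measurableSet_Ico)

theorem flo_vol (z : Fin n → ℤ) : volume (flo ⁻¹' {z} : Set (Vn n)) = 1 := by
  rw [flo_pre, (EuclideanSpace.volume_preserving_symm_measurableEquiv_toLp (Fin n)).measure_preimage
    (MeasurableSet.univ_pi fun i => measurableSet_Ico).nullMeasurableSet, Real.volume_pi_Ico]
  simp

theorem flo_int (g : (Fin n → ℤ) → ℝ) (S : Finset (Fin n → ℤ)) (hS : ∀ z ∉ S, g z = 0) :
    ∫ x : Vn n, g (flo x) = ∑ z ∈ S, g z := by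
  have e : (fun x : Vn n => g (flo x)) = fun x => ∑ z ∈ S, (flo ⁻¹' {z}).indicator (fun _ => g z) x := by
    funext x
    simp only [Set.indicator, Set.mem_preimage, Set.mem_singleton_iff]
    rw [Finset.sum_ite_eq]
    split_ifs with h
    · rfl
    · exact hS _ h
  rw [e, integral_finsetSum]
  · refine Finset.sum_congr rfl fun z _ => ?_
    rw [integral_indicator_const _ (flo_meas z), measureReal_def, flo_vol]
    simp
  · intro z _
    refine (integrable_indicator_iff (flo_meas z)).2 ?_
    refine integrableOn_const ?_ 
    rw [flo_vol]; simp

/-- the pieces -/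
def pc (Z : (Vn n → EReal) → ℝ) (u : Vn n → EReal) (z : Fin n → ℤ) : ℝ :=
  Zx Z (rst u (box (fun i => (z i : ℝ)) 1))

theorem sum_formula {Z : (Vn n → EReal) → ℝ} (H : Hyp Z) {u : Vn n → EReal} (hu : W u) (hb : Bdd u) :
    Zx Z u = ∫ x : Vn n, pc Z u (flo x) := by
  obtain ⟨R, hR⟩ := hb
  obtain ⟨N, hN⟩ := exists_nat_gt R
  have hN' : ∀ x ∈ dm u, ∀ i, -(N:ℝ) < x i ∧ x i < N := fun x hx i =>
    abs_lt.1 ((hR x hx i).trans_lt hN)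
  have hs := box_sum H (a := -N) (m := 2 * N) hu ⟨R, hR⟩ (fun x hx i => by
    have := hN' x hx i
    push_cast; constructor <;> linarith) Finset.univ
  simp only [Finset.mem_univ, if_true, cell_univ] at hs
  rw [hs, flo_int _ (Fintype.piFinset fun _ => Finset.Ico (-(N:ℤ)) (-(N:ℤ) + ((2 * N : ℕ) : ℤ)))]
  · rfl
  · intro z hz
    refine Zx_empty ?_
    rw [dm_rst, Set.eq_empty_iff_forall_notMem]
    rintro x ⟨hx, hxb⟩
    refine hz (Fintype.mem_piFinset.2 fun i => ?_)
    have h1 := hN' x hx i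
    have h2 := hxb i
    simp only [Pi.one_apply] at h2
    rw [Finset.mem_Ico]
    have h3 : (z i : ℝ) < N := by linarith
    have h4 : -(N:ℝ) < z i + 1 := by linarith
    have h3' : z i < N := by exact_mod_cast h3
    have h4' : -(N:ℤ) < z i + 1 := by exact_mod_cast h4
    push_cast
    omega

theorem scaled_formula {Z : (Vn n → EReal) → ℝ} (H : Hyp Z) {u : Vn n → EReal} (hu : W u) (hb : Bdd u)
    {l : ℝ} (hl : 0 < l) :
    Zx Z u = ∫ x : Vn n, pc Z (epiMul l u) (flo (l • x)) := by
  have hb' : Bdd (epiMul l u) := by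
    obtain ⟨R, hR⟩ := hb
    refine ⟨l * R, fun x hx i => ?_⟩
    have := hR _ ((mem_dm_epiMul hu.bot hl).1 hx) i
    simp only [PiLp.smul_apply, smul_eq_mul, abs_mul, abs_inv, abs_of_pos hl] at this
    rwa [← div_eq_inv_mul, div_le_iff₀ hl, mul_comm] at this
  rw [Measure.integral_comp_smul volume (fun x => pc Z (epiMul l u) (flo x)) l, ← sum_formula H (hu.epiMul hl) hb',
    Zx_epiMul H hu hl, finrank_euclideanSpace_fin, abs_of_pos (by positivity), smul_eq_mul]
  field_simp

end Cl


namespace Cl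
variable {n : ℕ}

/-- real function restricted to `C` -/
def re (f : Vn n → ℝ) (C : Set (Vn n)) : Vn n → EReal := rst (fun y => (f y : EReal)) C

theorem re_epi {C : Set (Vn n)} (hC : IsClosed C) {r : ℕ → Vn n → ℝ} {f : Vn n → ℝ} (hf : Continuous f)
    (h : TendstoUniformlyOn r f atTop C) : EpiConverges (fun k => re (r k) C) (re f C) := by
  classical
  have hout : ∀ x ∉ C, ∀ xk : ℕ → Vn n, Tendsto xk atTop (𝓝 x) →
      Tendsto (fun k => re (r k) C (xk k)) atTop (𝓝 ⊤) := by
    intro x hx xk hxk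
    refine tendsto_const_nhds.congr' ?_
    filter_upwards [hxk.eventually (hC.isOpen_compl.mem_nhds hx)] with k hk
    exact (rst_out hk).symm
  intro x
  by_cases hx : x ∈ C
  swap
  · have e : re f C x = ⊤ := rst_out hx
    rw [e]
    exact ⟨fun xk hxk => (hout x hx xk hxk).liminf_eq.ge, fun _ => x, tendsto_const_nhds,
      hout x hx _ tendsto_const_nhds⟩
  · have e : re f C x = (f x : EReal) := rst_in hx
    rw [e]
    refine ⟨fun xk hxk => ?_, fun _ => x, tendsto_const_nhds, ?_⟩
    · let s : ℕ → ℝ := fun k => if xk k ∈ C then r k (xk k) else f (xk k)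
      have hfx : Tendsto (fun k => f (xk k)) atTop (𝓝 (f x)) := (hf.tendsto x).comp hxk
      have hs : Tendsto s atTop (𝓝 (f x)) := by
        have h1 : Tendsto (fun k => s k - f (xk k)) atTop (𝓝 0) := by
          rw [Metric.tendsto_atTop']
          intro ε hε
          obtain ⟨N, hN⟩ := eventually_atTop.1 (Metric.tendstoUniformlyOn_iff.1 h ε hε)
          refine ⟨N, fun k hk => ?_⟩
          rw [Real.dist_0_eq_abs]
          simp only [s]
          split_ifs with hh
          · have := hN k hk.le _ hh
            rwa [dist_comm, Real.dist_eq] at this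
          · simpa using hε
        simpa using h1.add hfx
      have h2 : Tendsto (fun k => (s k : EReal)) atTop (𝓝 (f x : EReal)) := EReal.tendsto_coe.2 hs
      rw [← h2.liminf_eq]
      refine liminf_le_liminf (Eventually.of_forall fun k => ?_)
      show (s k : EReal) ≤ re (r k) C (xk k)
      simp only [s, re, rst]
      split_ifs
      · exact le_rfl
      · exact le_top
    · have : Tendsto (fun k => (r k x : EReal)) atTop (𝓝 (f x : EReal)) :=
        EReal.tendsto_coe.2 (h.tendsto_at hx)
      refine this.congr fun k => ?_
      exact (rst_in (u := fun y => (r k y : EReal)) hx).symm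

theorem lin_mem (p : Vn n) (c : ℝ) {C : Set (Vn n)} (hC : IsCompact C) (hcv : Convex ℝ C) (hne : C.Nonempty) :
    re (fun y => inner ℝ p y + c) C ∈ ConvSc n := by
  have hb : ∀ x, re (fun y => inner ℝ p y + c) C x ≠ ⊥ := by
    intro x
    by_cases hx : x ∈ C
    · rw [re, rst_in hx]; exact EReal.coe_ne_bot _
    · rw [re, rst_out hx]; simp
  have key : ∀ x (a : ℝ), re (fun y => inner ℝ p y + c) C x ≤ (a : EReal) ↔ x ∈ C ∧ inner ℝ p x + c ≤ a := by
    intro x a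
    by_cases hx : x ∈ C
    · rw [re, rst_in hx, EReal.coe_le_coe_iff]; simp [hx]
    · rw [re, rst_out hx]; simp [hx]
  refine ⟨⟨of_epi hb ?_, lsc_of_real hb ?_, hb, ?_⟩, ?_⟩
  · intro x y t a b ht0 ht1 ha hb
    obtain ⟨hx, ha⟩ := (key _ _).1 ha.le
    obtain ⟨hy, hb⟩ := (key _ _).1 hb.le
    refine (key _ _).2 ⟨hcv hx hy ht0.le (by linarith) (by ring), ?_⟩
    rw [inner_add_right, inner_smul_right, inner_smul_right]
    nlinarith
  · intro a
    simp only [key]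
    have hcl : IsClosed {x : Vn n | inner ℝ p x + c ≤ a} := isClosed_le (by fun_prop) continuous_const
    exact hC.isClosed.inter hcl
  · obtain ⟨x, hx⟩ := hne
    exact ⟨x, by rw [re, rst_in hx]; exact EReal.coe_ne_top _⟩
  · intro M
    obtain ⟨R, hR⟩ := hC.isBounded.exists_norm_le
    refine ⟨R + 1, fun x hx => ?_⟩
    rw [re, rst_out (fun h => by linarith [hR x h])]
    exact le_top

def zt (Z : (Vn n → EReal) → ℝ) (p : Vn n) : ℝ := Z (re (fun y => inner ℝ p y + 0) (box 0 1))

theorem box_ne : (box (0 : Fin n → ℝ) 1).Nonempty := ⟨0, fun i => by simp⟩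

theorem zt_cont {Z : (Vn n → EReal) → ℝ} (H : Hyp Z) : Continuous (zt Z) := by
  refine continuous_iff_seqContinuous.2 fun pk p hp => ?_
  refine H.c _ _ (fun k => lin_mem _ _ (box_compact 0 1) (box_convex 0 1) box_ne)
    (lin_mem _ _ (box_compact 0 1) (box_convex 0 1) box_ne) (re_epi (box_closed 0 1) (by fun_prop) ?_)
  obtain ⟨R, hR⟩ := (box_compact (0 : Fin n → ℝ) 1).isBounded.exists_norm_le
  rw [Metric.tendstoUniformlyOn_iff]
  intro ε hε
  have hR' : 0 < max R 1 := lt_of_lt_of_le one_pos (le_max_right _ _)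
  filter_upwards [Metric.tendsto_nhds.1 hp (ε / max R 1) (by positivity)] with k hk y hy
  simp only [Real.dist_eq]
  rw [show inner ℝ p y + 0 - (inner ℝ (pk k) y + 0) = inner ℝ (p - pk k) y by rw [inner_sub_left]; ring]
  refine (abs_real_inner_le_norm _ _).trans_lt ?_
  rw [dist_comm, dist_eq_norm, lt_div_iff₀ hR'] at hk
  refine lt_of_le_of_lt ?_ hk
  gcongr
  exact (hR y hy).trans (le_max_left _ _)

theorem norm_le_of_coord {x : Vn n} (h : ∀ i, |x i| ≤ 1) : ‖x‖ ≤ n := by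
  rw [EuclideanSpace.norm_eq]
  have h1 : ∑ i, ‖x i‖ ^ 2 ≤ (n : ℝ) := by
    calc ∑ i, ‖x i‖ ^ 2 ≤ ∑ i : Fin n, (1 : ℝ) := by
          refine Finset.sum_le_sum fun i _ => ?_
          rw [Real.norm_eq_abs]
          have := h i
          have := abs_nonneg (x i)
          nlinarith
      _ = n := by simp
  rw [Real.sqrt_le_left (by positivity)]
  refine h1.trans ?_
  rcases Nat.eq_zero_or_pos n with h | h
  · simp [h]
  · have : (1:ℝ) ≤ n := by exact_mod_cast h
    nlinarith

theorem pc_lim {Z : (Vn n → EReal) → ℝ} (H : Hyp Z) {u : Vn n → EReal} (hu : u ∈ ConvSc n) {x : Vn n}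
    (hx : x ∈ interior (dm u)) (hd : DifferentiableAt ℝ (rl u) x) :
    Tendsto (fun m : ℕ => pc Z (epiMul ((m : ℝ) + 1) u) (flo (((m : ℝ) + 1) • x))) atTop
      (𝓝 (zt Z (gradient (rl u) x))) := by
  have hb := hu.1.2.2.1
  have hW : W u := Or.inl hu
  set p := gradient (rl u) x with hp
  have hg : HasGradientAt (rl u) p x := hd.hasGradientAt
  let l : ℕ → ℝ := fun m => (m : ℝ) + 1
  have hl : ∀ m, 0 < l m := fun m => by simp only [l]; positivity
  let z : ℕ → Vn n := fun m => WithLp.toLp 2 (fun i => (flo (l m • x) i : ℝ))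
  let c : ℕ → ℝ := fun m => -(l m * rl u x) + inner ℝ p (l m • x - z m)
  let v : ℕ → Vn n → EReal := fun m y =>
    rst (epiMul (l m) u) (box (fun i => (flo (l m • x) i : ℝ)) 1) (y - -z m) + (c m : EReal)
  have hvW : ∀ m, W (v m) := fun m =>
    ((hW.epiMul (hl m)).rst (box_closed _ _) (box_convex _ _)).transl _ _
  have hpc : ∀ m, pc Z (epiMul (l m) u) (flo (l m • x)) = Zx Z (v m) := fun m =>
    (Zx_transl H ((hW.epiMul (hl m)).rst (box_closed _ _) (box_convex _ _)) _ _).symm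
  -- displacement
  let d : ℕ → Vn n → Vn n := fun m y => (l m)⁻¹ • (y + z m - l m • x)
  have hdn : ∀ m, ∀ y ∈ box (0 : Fin n → ℝ) 1, ‖d m y‖ ≤ (l m)⁻¹ * n := by
    intro m y hy
    simp only [d, norm_smul, norm_inv, Real.norm_of_nonneg (hl m).le]
    refine mul_le_mul_of_nonneg_left (norm_le_of_coord fun i => ?_) (inv_nonneg.2 (hl m).le)
    have h1 := hy i
    simp at h1
    have h2 := Int.floor_le (l m * x i)
    have h3 := Int.lt_floor_add_one (l m * x i)
    simp only [z, flo, PiLp.sub_apply, PiLp.add_apply, PiLp.smul_apply, smul_eq_mul]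
    rw [abs_le]
    constructor <;> linarith
  have hde : ∀ m y, (l m)⁻¹ • (y + z m) = x + d m y := by
    intro m y
    simp only [d]
    rw [smul_sub, smul_smul, inv_mul_cancel₀ (hl m).ne', one_smul]; abel
  let r : ℕ → Vn n → ℝ := fun m y => l m * rl u (x + d m y) + c m
  have hl0 : Tendsto (fun m => (l m)⁻¹ * (n : ℝ)) atTop (𝓝 0) := by
    have : Tendsto (fun m => (l m)⁻¹) atTop (𝓝 0) := by
      have := tendsto_one_div_add_atTop_nhds_zero_nat (𝕜 := ℝ)
      simpa [l] using this
    simpa using this.mul_const (n : ℝ)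
  have hball : ∃ δ > 0, ∀ w, ‖w‖ < δ → x + w ∈ dm u := by
    obtain ⟨δ, hδ, hs⟩ := Metric.mem_nhds_iff.1 (mem_interior_iff_mem_nhds.1 hx)
    refine ⟨δ, hδ, fun w hw => hs ?_⟩
    simpa [Metric.mem_ball, dist_eq_norm] using hw
  obtain ⟨δ, hδ, hin⟩ := hball
  have hvr : ∀ᶠ m in atTop, v m = re (r m) (box 0 1) := by
    filter_upwards [hl0.eventually_lt_const hδ] with m hm
    funext y
    have hmem : y - -z m ∈ box (fun i => (flo (l m • x) i : ℝ)) 1 ↔ y ∈ box (0 : Fin n → ℝ) 1 := by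
      simp only [mem_box]
      refine forall_congr' fun i => ?_
      simp [z]
      intro _
      constructor <;> intro h <;> linarith
    by_cases hy : y ∈ box (0 : Fin n → ℝ) 1
    · simp only [v, re]
      rw [rst_in (hmem.2 hy), rst_in hy, epiMul_eq (hl m), sub_neg_eq_add]
      beta_reduce
      rw [hde, ← coe_rl hb (hin _ ((hdn m y hy).trans_lt hm)), ← EReal.coe_mul, ← EReal.coe_add]
    · simp only [v, re]
      rw [rst_out (fun h => hy (hmem.1 h)), rst_out hy]
      simp
  have hun : TendstoUniformlyOn r (fun y => inner ℝ p y + 0) atTop (box 0 1) := by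
    rw [Metric.tendstoUniformlyOn_iff]
    intro ε hε
    have hlit := (hasGradientAt_iff_isLittleO_nhds_zero.1 hg).def (show 0 < ε / (n + 1) by positivity)
    obtain ⟨δ', hδ', hs⟩ := Metric.eventually_nhds_iff.1 hlit
    filter_upwards [hl0.eventually_lt_const hδ'] with m hm y hy
    have h1 := hdn m y hy
    have h2 := hs (y := d m y) (by rw [dist_zero_right]; exact h1.trans_lt hm)
    rw [dist_comm, Real.dist_eq]
    have e : r m y - (inner ℝ p y + 0) = l m * (rl u (x + d m y) - rl u x - inner ℝ p (d m y)) := by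
      have e1 : l m * inner ℝ p (d m y) = inner ℝ p y - inner ℝ p (l m • x - z m) := by
        rw [← inner_smul_right, ← inner_sub_right]
        congr 1
        simp only [d]
        rw [smul_smul, mul_inv_cancel₀ (hl m).ne', one_smul]; abel
      simp only [r, c]
      linarith
    rw [e, abs_mul, abs_of_pos (hl m)]
    rw [Real.norm_eq_abs] at h2
    calc l m * |rl u (x + d m y) - rl u x - inner ℝ p (d m y)| ≤ l m * (ε / (n + 1) * ‖d m y‖) :=
          mul_le_mul_of_nonneg_left h2 (hl m).le
      _ ≤ l m * (ε / (n + 1) * ((l m)⁻¹ * n)) := by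
          have := (hl m).le
          gcongr
      _ = ε * (n / (n + 1)) := by
          have := (hl m).ne'
          field_simp
      _ < ε := by
          refine mul_lt_of_lt_one_right hε ?_
          rw [div_lt_one (by positivity)]; linarith
  have hepi := re_epi (box_closed (0 : Fin n → ℝ) 1) (f := fun y => inner ℝ p y + 0) (by fun_prop) hun
  obtain ⟨N, hN⟩ := eventually_atTop.1 hvr
  have hvm : ∀ m, N ≤ m → v m ∈ ConvSc n := fun m hm => by
    refine (hvW m).mem ?_
    obtain ⟨y, hy⟩ := box_ne (n := n)
    refine ⟨y, ?_⟩
    rw [hN m hm]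
    show re _ _ y ≠ ⊤
    rw [re, rst_in hy]; exact EReal.coe_ne_top _
  rw [← tendsto_add_atTop_iff_nat N]
  have hfin := H.c (fun k => v (k + N)) _ (fun k => hvm _ (Nat.le_add_left _ _))
    (lin_mem p 0 (box_compact 0 1) (box_convex 0 1) box_ne) (by
      have : (fun k => v (k + N)) = fun k => re (r (k + N)) (box 0 1) :=
        funext fun k => hN _ (Nat.le_add_left _ _)
      rw [this]
      exact epi_subseq hepi (φ := fun k => k + N) (fun a b h => Nat.add_lt_add_right h N))
  refine hfin.congr fun k => ?_
  have := hpc (k + N)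
  rw [Zx_mem (hvm _ (Nat.le_add_left _ _))] at this
  exact this.symm

theorem pc_out {Z : (Vn n → EReal) → ℝ} {u : Vn n → EReal} (hb : ∀ x, u x ≠ ⊥) {l : ℝ} (hl : 0 < l) {x : Vn n}
    (h : pc Z (epiMul l u) (flo (l • x)) ≠ 0) : ∃ y ∈ dm u, ‖y - x‖ ≤ l⁻¹ * n := by
  by_contra hcon
  push Not at hcon
  refine h (Zx_empty ?_)
  rw [dm_rst, Set.eq_empty_iff_forall_notMem]
  rintro y ⟨hy, hyb⟩
  have h1 := (mem_dm_epiMul hb hl).1 hy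
  refine not_le.2 (hcon _ h1) ?_
  have e : l⁻¹ • y - x = l⁻¹ • (y - l • x) := by
    rw [smul_sub, smul_smul, inv_mul_cancel₀ hl.ne', one_smul]
  rw [e, norm_smul, norm_inv, Real.norm_of_nonneg hl.le]
  refine mul_le_mul_of_nonneg_left (norm_le_of_coord fun i => ?_) (inv_nonneg.2 hl.le)
  have h2 := hyb i
  have h3 := Int.floor_le (l * x i)
  have h4 := Int.lt_floor_add_one (l * x i)
  simp only [flo, PiLp.sub_apply, PiLp.smul_apply, smul_eq_mul, Pi.one_apply] at h2 ⊢
  rw [abs_le]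
  constructor <;> linarith

theorem flo_measurable : Measurable (flo : Vn n → Fin n → ℤ) := by
  refine measurable_pi_lambda _ fun i => ?_
  exact Int.measurable_floor.comp (coord_cont i).measurable

theorem bdd_formula {Z : (Vn n → EReal) → ℝ} (H : Hyp Z) {u : Vn n → EReal} (hu : u ∈ ConvSc n) (hbd : Bdd u) :
    Z u = ∫ x, Fz (zt Z) u x := by
  have hb := hu.1.2.2.1
  have hW : W u := Or.inl hu
  obtain ⟨C, hC0, hC⟩ := bound H
  obtain ⟨R, hR⟩ : ∃ R : ℝ, ∀ x ∈ dm u, ‖x‖ ≤ R := by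
    obtain ⟨R, hR⟩ := hbd
    obtain ⟨R', hR'⟩ := (box_compact (fun _ : Fin n => -R) (fun _ => 2 * R)).isBounded.exists_norm_le
    refine ⟨R', fun x hx => hR' x fun i => ?_⟩
    have := abs_le.1 (hR x hx i)
    constructor <;> linarith
  let g : ℕ → Vn n → ℝ := fun m x => pc Z (epiMul ((m : ℝ) + 1) u) (flo (((m : ℝ) + 1) • x))
  have hl : ∀ m : ℕ, 0 < (m : ℝ) + 1 := fun m => by positivity
  have hlim : Tendsto (fun m => ∫ x, g m x) atTop (𝓝 (∫ x, Fz (zt Z) u x)) := by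
    refine tendsto_integral_of_dominated_convergence
      ((Metric.closedBall (0 : Vn n) (R + n)).indicator fun _ => C) ?_ ?_ ?_ ?_
    · intro m
      have : Measurable (pc Z (epiMul ((m : ℝ) + 1) u)) := measurable_of_countable _
      exact (this.comp (flo_measurable.comp (measurable_const_smul _))).aestronglyMeasurable
    · refine (integrable_indicator_iff measurableSet_closedBall).2 ?_
      exact integrableOn_const (isCompact_closedBall _ _).measure_lt_top.ne
    · intro m
      refine Eventually.of_forall fun x => ?_
      by_cases h0 : g m x = 0
      · rw [h0, norm_zero]
        exact Set.indicator_nonneg (fun _ _ => hC0) _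
      · obtain ⟨y, hy, hyx⟩ := pc_out hb (hl m) h0
        rw [Set.indicator_of_mem]
        · exact hC _ ((hW.epiMul (hl m)).rst (box_closed _ _) (box_convex _ _)) _
            (by rw [dm_rst]; exact Set.inter_subset_right)
        · rw [mem_closedBall_zero_iff]
          have h1 : ‖x‖ ≤ ‖y‖ + ‖y - x‖ := by
            have := norm_sub_le y (y - x)
            simpa using this
          have h2 : ((m : ℝ) + 1)⁻¹ * n ≤ n := mul_le_of_le_one_left (by positivity)
            (inv_le_one_of_one_le₀ (by have : (0:ℝ) ≤ m := by positivity
                                       linarith))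
          linarith [hR y hy]
    · filter_upwards [ae_good hu.1.1 hb] with x hx
      rcases hx with ⟨h1, h2⟩ | h1
      · have := pc_lim H hu h1 h2
        have e : Fz (zt Z) u x = zt Z (gradient (rl u) x) := by
          simp only [Fz, Set.indicator_of_mem h1]
        rw [e]; exact this
      · rw [Fz_out h1]
        refine tendsto_const_nhds.congr' ?_
        obtain ⟨δ, hδ, hs⟩ := Metric.mem_nhds_iff.1 (isClosed_closure.isOpen_compl.mem_nhds h1)
        have hl0 : Tendsto (fun m : ℕ => ((m : ℝ) + 1)⁻¹ * (n : ℝ)) atTop (𝓝 0) := by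
          have := (tendsto_one_div_add_atTop_nhds_zero_nat (𝕜 := ℝ)).mul_const (n : ℝ)
          simpa using this
        filter_upwards [hl0.eventually_lt_const hδ] with m hm
        by_contra h0
        obtain ⟨y, hy, hyx⟩ := pc_out hb (hl m) (fun h => h0 h.symm)
        refine hs (?_ : y ∈ _) (subset_closure hy)
        rw [Metric.mem_ball, dist_eq_norm]; exact hyx.trans_lt hm
  have hconst : ∀ m, ∫ x, g m x = Z u := fun m => by
    rw [← Zx_mem (Z := Z) hu, scaled_formula H hW hbd (hl m)]
  simp only [hconst] at hlim
  exact tendsto_nhds_unique tendsto_const_nhds hlim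

end Cl


namespace Cl
variable {n : ℕ}

def cone (p : Vn n) : Set (Vn n) := {x | ‖p‖ * ‖x‖ ≤ 2 * inner ℝ p x} ∩ {x | inner ℝ p x ≤ 1}

theorem cone_closed (p : Vn n) : IsClosed (cone p) :=
  (isClosed_le (by fun_prop) (by fun_prop)).inter (isClosed_le (by fun_prop) (by fun_prop))

theorem cone_convex (p : Vn n) : Convex ℝ (cone p) := by
  rintro x ⟨hx1, hx2⟩ y ⟨hy1, hy2⟩ a b ha hb hab
  simp only [Set.mem_ofPred_eq] at *
  refine ⟨?_, ?_⟩
  · simp only [Set.mem_ofPred_eq]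
    rw [inner_add_right, inner_smul_right, inner_smul_right]
    have h1 := norm_add_le (a • x) (b • y)
    rw [norm_smul, norm_smul, Real.norm_of_nonneg ha, Real.norm_of_nonneg hb] at h1
    calc ‖p‖ * ‖a • x + b • y‖ ≤ ‖p‖ * (a * ‖x‖ + b * ‖y‖) := by gcongr
      _ = a * (‖p‖ * ‖x‖) + b * (‖p‖ * ‖y‖) := by ring
      _ ≤ a * (2 * inner ℝ p x) + b * (2 * inner ℝ p y) := by gcongr
      _ = _ := by ring
  · simp only [Set.mem_ofPred_eq]
    rw [inner_add_right, inner_smul_right, inner_smul_right]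
    calc a * inner ℝ p x + b * inner ℝ p y ≤ a * 1 + b * 1 := by gcongr
      _ = 1 := by linarith

theorem cone_norm {p x : Vn n} (hp : p ≠ 0) (hx : x ∈ cone p) : ‖x‖ ≤ 2 / ‖p‖ := by
  rw [le_div_iff₀ (norm_pos_iff.2 hp)]
  have h1 : ‖p‖ * ‖x‖ ≤ 2 * inner ℝ p x := hx.1
  have h2 : inner ℝ p x ≤ 1 := hx.2
  linarith

theorem cone_compact {p : Vn n} (hp : p ≠ 0) : IsCompact (cone p) :=
  Metric.isCompact_of_isClosed_isBounded (cone_closed p)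
    ((isBounded_iff_forall_norm_le).2 ⟨_, fun _ hx => cone_norm hp hx⟩)

theorem cone_zero (p : Vn n) : (0 : Vn n) ∈ cone p := by
  constructor <;> simp

theorem cone_int {p : Vn n} (hp : p ≠ 0) : (interior (cone p)).Nonempty := by
  have ho : IsOpen ({x : Vn n | ‖p‖ * ‖x‖ < 2 * inner ℝ p x} ∩ {x | inner ℝ p x < 1}) :=
    (isOpen_lt (by fun_prop) (by fun_prop)).inter (isOpen_lt (by fun_prop) (by fun_prop))
  have hs : ({x : Vn n | ‖p‖ * ‖x‖ < 2 * inner ℝ p x} ∩ {x | inner ℝ p x < 1}) ⊆ cone p :=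
    fun x hx => ⟨LT.lt.le (show ‖p‖ * ‖x‖ < 2 * inner ℝ p x from hx.1), LT.lt.le (show inner ℝ p x < 1 from hx.2)⟩
  have hp' := norm_pos_iff.2 hp
  refine ⟨(1 / (2 * ‖p‖ ^ 2)) • p, interior_maximal hs ho ⟨?_, ?_⟩⟩
  · simp only [Set.mem_ofPred_eq]
    rw [inner_smul_right, real_inner_self_eq_norm_sq, norm_smul, Real.norm_of_nonneg (by positivity)]
    field_simp
    norm_num
  · simp only [Set.mem_ofPred_eq]
    rw [inner_smul_right, real_inner_self_eq_norm_sq]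
    field_simp
    norm_num

theorem dm_re (f : Vn n → ℝ) (C : Set (Vn n)) : dm (re f C) = C := by
  rw [re, dm_rst, Set.inter_eq_right]
  intro x _
  exact EReal.coe_ne_top _

theorem bdd_of_compact {u : Vn n → EReal} {C : Set (Vn n)} (hC : IsCompact C) (h : dm u ⊆ C) : Bdd u := by
  obtain ⟨R, hR⟩ := hC.isBounded.exists_norm_le
  refine ⟨R, fun x hx i => ?_⟩
  exact (PiLp.norm_apply_le x i).trans (hR x (h hx))

theorem Z_lin {Z : (Vn n → EReal) → ℝ} (H : Hyp Z) (p : Vn n) {C : Set (Vn n)} (hC : IsCompact C)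
    (hcv : Convex ℝ C) (hne : C.Nonempty) :
    Z (re (fun y => inner ℝ p y + 0) C) = (volume (interior C)).toReal * zt Z p := by
  rw [bdd_formula H (lin_mem p 0 hC hcv hne) (bdd_of_compact hC (dm_re _ _).subset)]
  have e : Fz (zt Z) (re (fun y => inner ℝ p y + 0) C) = (interior C).indicator fun _ => zt Z p := by
    funext x
    rw [Fz, dm_re]
    by_cases hx : x ∈ interior C
    · rw [Set.indicator_of_mem hx, Set.indicator_of_mem hx]
      congr 1
      have h1 : rl (re (fun y => inner ℝ p y + 0) C) =ᶠ[𝓝 x] fun y => inner ℝ p y := by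
        filter_upwards [mem_interior_iff_mem_nhds.1 hx] with y hy
        simp [rl, re, rst_in hy]
      have h2 : HasGradientAt (fun y => inner ℝ p y) p x := by
        rw [hasGradientAt_iff_hasFDerivAt]
        exact ((InnerProductSpace.toDual ℝ (Vn n)) p).hasFDerivAt
      exact (h2.congr_of_eventuallyEq h1).gradient
    · rw [Set.indicator_of_notMem hx, Set.indicator_of_notMem hx]
  rw [e, integral_indicator_const _ isOpen_interior.measurableSet]
  rfl

theorem re_zero_Z {Z : (Vn n → EReal) → ℝ} (H : Hyp Z) (i : Fin n) :
    Z (re (fun y => inner ℝ (0 : Vn n) y + 0) {0}) = 0 := by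
  have hm := lin_mem (0 : Vn n) 0 (isCompact_singleton (x := (0 : Vn n))) (convex_singleton 0)
    (Set.singleton_nonempty 0)
  rw [← Zx_mem (Z := Z) hm]
  refine vanish H (Or.inl hm) (bdd_of_compact isCompact_singleton (dm_re _ _).subset) i 0 ?_
  intro x hx
  rw [dm_re] at hx
  rw [Set.mem_singleton_iff.1 hx]; rfl

theorem zt_supp {Z : (Vn n → EReal) → ℝ} (H : Hyp Z) : HasCompactSupport (zt Z) := by
  by_contra hcon
  have hun : ∀ k : ℕ, ∃ p : Vn n, (k : ℝ) < ‖p‖ ∧ zt Z p ≠ 0 := by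
    intro k
    by_contra hk
    push Not at hk
    refine hcon (HasCompactSupport.intro (isCompact_closedBall 0 (k : ℝ)) fun x hx => hk x ?_)
    simpa using hx
  choose p hp hz using hun
  have hp0 : ∀ k, p k ≠ 0 := fun k => norm_pos_iff.1 (lt_of_le_of_lt (Nat.cast_nonneg k) (hp k))
  have hn : n ≠ 0 := by
    rintro rfl
    exact hp0 0 (Subsingleton.elim _ _)
  let U : ℕ → Vn n → EReal := fun k => re (fun y => inner ℝ (p k) y + 0) (cone (p k))
  have hU : ∀ k, U k ∈ ConvSc n := fun k =>
    lin_mem _ _ (cone_compact (hp0 k)) (cone_convex _) ⟨0, cone_zero _⟩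
  have hZU : ∀ k, Z (U k) ≠ 0 := fun k => by
    simp only [U]
    rw [Z_lin H _ (cone_compact (hp0 k)) (cone_convex _) ⟨0, cone_zero _⟩]
    refine mul_ne_zero ?_ (hz k)
    refine (ENNReal.toReal_pos (isOpen_interior.measure_pos _ (cone_int (hp0 k))).ne' ?_).ne'
    exact ((measure_mono interior_subset).trans_lt (cone_compact (hp0 k)).measure_lt_top).ne
  let s : ℕ → ℝ := fun k => |Z (U k)| ^ (-(1 / (n : ℝ)))
  have hs : ∀ k, 0 < s k := fun k => Real.rpow_pos_of_pos (abs_pos.2 (hZU k)) _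
  let V : ℕ → Vn n → EReal := fun k => epiMul (s k) (U k)
  have hV : ∀ k, V k ∈ ConvSc n := fun k => epiMul_mem (hU k) (hs k)
  have hZV : ∀ k, |Z (V k)| = 1 := fun k => by
    simp only [V]
    rw [H.h _ (hU k) _ (hs k), abs_mul, abs_of_pos (Real.rpow_pos_of_pos (hs k) _)]
    simp only [s]
    rw [← Real.rpow_mul (abs_nonneg _)]
    have : -(1 / (n : ℝ)) * n = -1 := by
      have : (n : ℝ) ≠ 0 := by exact_mod_cast hn
      field_simp
    rw [this, Real.rpow_neg_one, inv_mul_cancel₀ (abs_pos.2 (hZU k)).ne']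
  have hlowU : ∀ (k : ℕ) (x : Vn n), (((k : ℝ) / 2 * ‖x‖ : ℝ) : EReal) ≤ U k x := fun k x => by
    by_cases hx : x ∈ cone (p k)
    · simp only [U, re]
      rw [rst_in hx, EReal.coe_le_coe_iff]
      have h1 : ‖p k‖ * ‖x‖ ≤ 2 * inner ℝ (p k) x := hx.1
      have h2 := mul_le_mul_of_nonneg_right (hp k).le (norm_nonneg x)
      linarith
    · simp only [U, re]
      rw [rst_out hx]; exact le_top
  have hlow : ∀ (k : ℕ) (x : Vn n), (((k : ℝ) / 2 * ‖x‖ : ℝ) : EReal) ≤ V k x := fun k x => by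
    simp only [V]
    rw [epiMul_eq (hs k)]
    have h1 := hlowU k ((s k)⁻¹ • x)
    have e : (k / 2 * ‖x‖ : ℝ) = s k * (k / 2 * ‖(s k)⁻¹ • x‖) := by
      have := (hs k).ne'
      rw [norm_smul, norm_inv, Real.norm_of_nonneg (hs k).le]; field_simp
    rw [e, EReal.coe_mul]
    exact mul_le_mul_of_nonneg_left h1 (by exact_mod_cast (hs k).le)
  have hV0 : ∀ k, V k 0 = 0 := fun k => by
    simp only [V]
    rw [epiMul_eq (hs k)]
    simp [U, re, rst_in (cone_zero (p k))]
  have hE : EpiConverges V (re (fun y => inner ℝ (0 : Vn n) y + 0) {0}) := by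
    intro x
    have hinf : x ≠ 0 → ∀ xk : ℕ → Vn n, Tendsto xk atTop (𝓝 x) →
        Tendsto (fun k => V k (xk k)) atTop (𝓝 ⊤) := by
      intro hx xk hxk
      have h1 : Tendsto (fun k : ℕ => (k : ℝ) / 2 * ‖xk k‖) atTop atTop :=
        (tendsto_natCast_atTop_atTop.atTop_div_const two_pos).atTop_mul_pos (norm_pos_iff.2 hx) hxk.norm
      have h2 : Tendsto (fun k : ℕ => (((k : ℝ) / 2 * ‖xk k‖ : ℝ) : EReal)) atTop (𝓝 ⊤) :=
        EReal.tendsto_coe_nhds_top_iff.2 h1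
      exact tendsto_of_tendsto_of_tendsto_of_le_of_le h2 tendsto_const_nhds
        (fun k => hlow k _) (fun k => le_top)
    by_cases hx : x = 0
    · have e : re (fun y => inner ℝ (0 : Vn n) y + 0) {0} x = 0 := by
        rw [re, rst_in (Set.mem_singleton_iff.2 hx)]; simp
      rw [e]
      refine ⟨fun xk hxk => ?_, fun _ => 0, hx ▸ tendsto_const_nhds, ?_⟩
      · refine le_liminf_of_le (by isBoundedDefault) (Eventually.of_forall fun k => ?_)
        refine le_trans ?_ (hlow k (xk k))
        exact_mod_cast (by positivity : (0:ℝ) ≤ k / 2 * ‖xk k‖)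
      · simp [hV0]
    · have e : re (fun y => inner ℝ (0 : Vn n) y + 0) {0} x = ⊤ := rst_out hx
      rw [e]
      exact ⟨fun xk hxk => (hinf hx xk hxk).liminf_eq.ge, fun _ => x, tendsto_const_nhds,
        hinf hx _ tendsto_const_nhds⟩
  have hlim := (H.c _ _ hV (lin_mem (0 : Vn n) 0 isCompact_singleton (convex_singleton 0)
    (Set.singleton_nonempty 0)) hE).abs
  rw [re_zero_Z H ⟨0, Nat.pos_of_ne_zero hn⟩] at hlim
  simp only [hZV, abs_zero] at hlim
  exact one_ne_zero (tendsto_nhds_unique tendsto_const_nhds hlim)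

theorem rst_epi {u : Vn n → EReal} (hu : LowerSemicontinuous u) {S : ℕ → Set (Vn n)}
    (hS : ∀ x, ∀ᶠ k in atTop, x ∈ S k) : EpiConverges (fun k => rst u (S k)) u := by
  intro x
  refine ⟨fun xk hxk => ?_, fun _ => x, tendsto_const_nhds, ?_⟩
  · refine le_of_forall_lt fun a ha => ?_
    obtain ⟨b, hab, hb⟩ := exists_between ha
    refine hab.trans_le (le_liminf_of_le (by isBoundedDefault) ?_)
    filter_upwards [hxk.eventually (hu x b hb)] with k hk
    refine hk.le.trans ?_
    by_cases h : xk k ∈ S k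
    · rw [rst_in h]
    · rw [rst_out h]; exact le_top
  · refine tendsto_const_nhds.congr' ?_
    filter_upwards [hS x] with k hk
    exact (rst_in hk).symm

theorem full_formula {Z : (Vn n → EReal) → ℝ} (H : Hyp Z) {u : Vn n → EReal} (hu : u ∈ ConvSc n) :
    Z u = ∫ x, Fz (zt Z) u x := by
  obtain ⟨x0, hx0⟩ := hu.1.2.2.2
  obtain ⟨N, hN⟩ := exists_nat_gt ‖x0‖
  let S : ℕ → Set (Vn n) := fun k => Metric.closedBall 0 ((k + N : ℕ) : ℝ)
  have hS : ∀ x : Vn n, ∀ᶠ k in atTop, x ∈ S k := by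
    intro x
    obtain ⟨K, hK⟩ := exists_nat_gt ‖x‖
    filter_upwards [eventually_ge_atTop K] with k hk
    simp only [S, mem_closedBall_zero_iff]
    have : (K : ℝ) ≤ ((k + N : ℕ) : ℝ) := by exact_mod_cast (by omega : K ≤ k + N)
    linarith
  have hm : ∀ k, rst u (S k) ∈ ConvSc n := fun k => by
    refine rst_mem hu Metric.isClosed_closedBall (convex_closedBall _ _) ⟨x0, hx0, ?_⟩
    simp only [S, mem_closedBall_zero_iff]
    have : (N : ℝ) ≤ ((k + N : ℕ) : ℝ) := by exact_mod_cast (by omega : N ≤ k + N)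
    linarith
  have hE := rst_epi hu.1.2.1 hS
  have h1 := H.c _ _ hm hu hE
  have h2 := int_continuous (zt_cont H) (zt_supp H) _ _ hm hu hE
  refine tendsto_nhds_unique h1 (h2.congr fun k => ?_)
  refine (bdd_formula H (hm k) (bdd_of_compact (isCompact_closedBall (0 : Vn n) ((k + N : ℕ) : ℝ)) ?_)).symm
  rw [dm_rst]; exact Set.inter_subset_right

end Cl

/-- **Classification of `n`-epi-homogeneous valuations** (Theorem 2):
`Z : Conv_sc(ℝⁿ) → ℝ` is a continuous, epi-translation invariant valuation
that is epi-homogeneous of degree `n` if and only if there is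
`ζ ∈ C_c(ℝⁿ)` with `Z(u) = ∫_{dom u} ζ(∇u(x)) dx` for all `u ∈ Conv_sc(ℝⁿ)`.
(The gradient of `u` is expressed through the gradient of the real-valued
function `x ↦ (u x).toReal`, which agrees with `∇u` a.e. on `dom u`.) -/
theorem classification_n_epihomogeneous (n : ℕ) (Z : (Vn n → EReal) → ℝ) :
    (ContinuousVal (ConvSc n) Z ∧ IsValuation (ConvSc n) Z ∧
      EpiTranslationInvariant (ConvSc n) Z ∧
      EpiHomogeneous (ConvSc n) Z (n : ℝ)) ↔
    (∃ ζ : Vn n → ℝ, Continuous ζ ∧ HasCompactSupport ζ ∧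
      ∀ u ∈ ConvSc n,
        Z u = ∫ x in {x : Vn n | u x ≠ ⊤},
          ζ (gradient (fun y => (u y).toReal) x)) := by
  constructor
  · rintro ⟨h1, h2, h3, h4⟩
    have H : Cl.Hyp Z := ⟨h1, h2, h3, h4⟩
    refine ⟨Cl.zt Z, Cl.zt_cont H, Cl.zt_supp H, fun u hu => ?_⟩
    rw [Cl.int_eq hu.1.1 hu.1.2.2.1]
    exact Cl.full_formula H hu
  · rintro ⟨ζ, hζ, hc, h⟩
    have e : ∀ u ∈ ConvSc n, Z u = ∫ x, Cl.Fz ζ u x := fun u hu => by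
      rw [h u hu, Cl.int_eq hu.1.1 hu.1.2.2.1]
    refine ⟨?_, ?_, ?_, ?_⟩
    · intro uk u hk hu hE
      rw [e u hu]
      exact (Cl.int_continuous hζ hc uk u hk hu hE).congr fun k => (e _ (hk k)).symm
    · intro u v hu hv h1 h2
      rw [e _ hu, e _ hv, e _ h1, e _ h2]
      exact Cl.int_valuation hζ hc u v hu hv h1 h2
    · intro u hu x₀ c
      rw [e _ hu, e _ (Cl.transl_mem hu x₀ c)]
      exact Cl.int_transl ζ u hu x₀ c
    · intro u hu l hl
      rw [e _ hu, e _ (Cl.epiMul_mem hu hl)]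
      exact Cl.int_homog ζ u hu l hl
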